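/- arXiv:1301.5447 — 5 statements merged into one kernel-verified Lean document; each statement's English description precedes it below -/
import Mathlib

section
/- For every A > 0 there exists a constant C = C(A) > 0 such that for every a with 0 < a ≤ A and every s > 0 one has ∑_{m=0}^∞ s^m / (m! · Γ(m+a)) ≤ C · e^{2√s} / s^{a/2 − 1/4} · (1 + e^{C/(2√s)} / √s). -/
lemma aux_G1 {x b : ℝ} (hx : 0 < x) (hb0 : 0 ≤ b) (hb1 : b ≤ 1) :
    Real.Gamma (x + b) ≤ Real.Gamma x * x ^ b := by
  rcases hb0.eq_or_lt with rfl | hb0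
  · simp
  rcases hb1.eq_or_lt with rfl | hb1
  · rw [Real.Gamma_add_one hx.ne', Real.rpow_one, mul_comm]
  have h := Real.Gamma_mul_add_mul_le_rpow_Gamma_mul_rpow_Gamma hx (add_pos hx one_pos)
    (sub_pos.2 hb1) hb0 (by ring)
  have hG := Real.Gamma_pos_of_pos hx
  rw [Real.Gamma_add_one hx.ne', Real.mul_rpow hx.le hG.le] at h
  have e : (1 - b) * x + b * (x + 1) = x + b := by ring
  rw [e] at h
  refine h.trans (le_of_eq ?_)
  have : Real.Gamma x ^ (1 - b) * Real.Gamma x ^ b = Real.Gamma x := by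
    rw [← Real.rpow_add hG]; simp
  calc _ = (Real.Gamma x ^ (1 - b) * Real.Gamma x ^ b) * x ^ b := by ring
    _ = _ := by rw [this]

lemma aux_E {y b : ℝ} (n : ℕ) (hy : 0 < y) (hb0 : 0 ≤ b) (hb1 : b ≤ 1) :
    y ^ ((n : ℝ) + b) / Real.Gamma (n + 1 + b) ≤
      y ^ (n + 1) / ((n + 1).factorial : ℝ) + 2 * (y ^ n / (n.factorial : ℝ)) := by
  have hp : (0 : ℝ) < n + 1 + b := by positivity
  have hG := Real.Gamma_pos_of_pos hp
  have h := aux_G1 hp (sub_nonneg.2 hb1) (by linarith : 1 - b ≤ 1)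
  have e : (n : ℝ) + 1 + b + (1 - b) = ((n + 1 : ℕ) : ℝ) + 1 := by push_cast; ring
  rw [e, Real.Gamma_nat_eq_factorial] at h
  have hf : (0 : ℝ) < ((n + 1).factorial : ℝ) := by positivity
  have hf0 : (0 : ℝ) < (n.factorial : ℝ) := by positivity
  have h1 : y ^ ((n : ℝ) + b) * (n + 1 + b) ^ (1 - b) ≤ y ^ (n + 1) + (n + 2) * y ^ n := by
    have e1 : y ^ ((n : ℝ) + b) = y ^ n * y ^ b := by
      rw [Real.rpow_add hy, Real.rpow_natCast]
    have e2 : y ^ b * (n + 1 + b) ^ (1 - b) ≤ y + (n + 2) := by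
      have := Real.geom_mean_le_arith_mean2_weighted hb0 (sub_nonneg.2 hb1) hy.le hp.le (by ring)
      refine this.trans ?_
      have : (1 - b) * (n + 1 + b) ≤ 1 * (n + 2) := by
        apply mul_le_mul <;> linarith
      nlinarith
    rw [e1, mul_assoc]
    calc _ ≤ y ^ n * (y + (n + 2)) := by gcongr
      _ = _ := by ring
  have h2 : y ^ ((n : ℝ) + b) / Real.Gamma (n + 1 + b) ≤
      (y ^ (n + 1) + (n + 2) * y ^ n) / ((n + 1).factorial : ℝ) := by
    rw [div_le_div_iff₀ hG hf]
    have hy' : 0 < y ^ ((n : ℝ) + b) := Real.rpow_pos_of_pos hy _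
    calc _ ≤ y ^ ((n : ℝ) + b) * (Real.Gamma (n + 1 + b) * (n + 1 + b) ^ (1 - b)) := by gcongr
      _ = (y ^ ((n : ℝ) + b) * (n + 1 + b) ^ (1 - b)) * Real.Gamma (n + 1 + b) := by ring
      _ ≤ _ := by gcongr
  refine h2.trans ?_
  rw [add_div]
  gcongr
  rw [Nat.factorial_succ]
  push_cast
  rw [← mul_div_assoc, div_le_div_iff₀ (by positivity) hf0]
  have : 0 ≤ y ^ n * (n.factorial : ℝ) := by positivity
  have hn : (0 : ℝ) ≤ n := by positivity
  nlinarith [mul_nonneg this hn]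

lemma aux_prod {q : ℝ} (hq : 3 / 2 ≤ q) :
    Real.Gamma (q - 1 / 4) * Real.Gamma (q + 1 / 4) ≤ 3 * Real.Gamma q ^ 2 := by
  have hq0 : 0 < q := by linarith
  have hq1 : 0 < q - 1 := by linarith
  have h1 := aux_G1 (b := 1 / 4) hq0 (by norm_num) (by norm_num)
  have h2 := aux_G1 (b := 3 / 4) hq1 (by norm_num) (by norm_num)
  have e : q - 1 + 3 / 4 = q - 1 / 4 := by ring
  rw [e] at h2
  have h3 : Real.Gamma q = (q - 1) * Real.Gamma (q - 1) := by
    rw [← Real.Gamma_add_one hq1.ne']; ring_nf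
  have hG1 := Real.Gamma_pos_of_pos hq1
  have hG := Real.Gamma_pos_of_pos hq0
  have h4 : q ^ (1 / 4 : ℝ) ≤ 3 * (q - 1) ^ (1 / 4 : ℝ) := by
    calc q ^ (1 / 4 : ℝ) ≤ (3 * (q - 1)) ^ (1 / 4 : ℝ) := by
          apply Real.rpow_le_rpow <;> linarith
      _ = 3 ^ (1 / 4 : ℝ) * (q - 1) ^ (1 / 4 : ℝ) := Real.mul_rpow (by norm_num) hq1.le
      _ ≤ _ := by
          gcongr
          calc (3 : ℝ) ^ (1 / 4 : ℝ) ≤ 3 ^ (1 : ℝ) := by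
                apply Real.rpow_le_rpow_of_exponent_le <;> norm_num
            _ = 3 := by simp
  have h5 : (q - 1) ^ (3 / 4 : ℝ) * (q - 1) ^ (1 / 4 : ℝ) = q - 1 := by
    rw [← Real.rpow_add hq1]; norm_num
  calc _ ≤ (Real.Gamma (q - 1) * (q - 1) ^ (3 / 4 : ℝ)) * (Real.Gamma q * q ^ (1 / 4 : ℝ)) := by
        apply mul_le_mul h2 h1 (Real.Gamma_pos_of_pos (by linarith)).le (by positivity)
    _ ≤ (Real.Gamma (q - 1) * (q - 1) ^ (3 / 4 : ℝ)) *
        (Real.Gamma q * (3 * (q - 1) ^ (1 / 4 : ℝ))) := by gcongr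
    _ = 3 * ((q - 1) * Real.Gamma (q - 1)) * Real.Gamma q := by
        nth_rewrite 4 [← h5]; ring
    _ = _ := by rw [← h3]; ring

lemma aux_mid {u v : ℝ} (hu : 0 < u) (hv : 0 < v) :
    Real.Gamma ((u + v) / 2) ^ 2 ≤ Real.Gamma u * Real.Gamma v := by
  have h := Real.Gamma_mul_add_mul_le_rpow_Gamma_mul_rpow_Gamma hu hv
    (by norm_num : (0 : ℝ) < 1 / 2) (by norm_num : (0 : ℝ) < 1 / 2) (by norm_num)
  have hU := Real.Gamma_pos_of_pos hu
  have hV := Real.Gamma_pos_of_pos hv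
  have e : 1 / 2 * u + 1 / 2 * v = (u + v) / 2 := by ring
  rw [e, ← Real.sqrt_eq_rpow, ← Real.sqrt_eq_rpow, ← Real.sqrt_mul hU.le] at h
  have h0 : 0 ≤ Real.Gamma ((u + v) / 2) := (Real.Gamma_pos_of_pos (by linarith)).le
  calc _ ≤ Real.sqrt (Real.Gamma u * Real.Gamma v) ^ 2 := by gcongr
    _ = _ := Real.sq_sqrt (by positivity)

/-- lower bound for the denominators -/
lemma aux_low {a : ℝ} (ha : 0 < a) (m : ℕ) (hm : 1 ≤ m) :
    Real.Gamma (2 * m + a + 1 / 2) * 2 ^ (1 - (2 * m + a + 1 / 2)) ≤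
      3 * ((m.factorial : ℝ) * Real.Gamma (m + a)) := by
  have hm' : (1 : ℝ) ≤ m := by exact_mod_cast hm
  have h1 := aux_mid (u := (m : ℝ) + 1) (v := m + a) (by linarith) (by linarith)
  rw [Real.Gamma_nat_eq_factorial] at h1
  have h2 := aux_prod (q := ((m : ℝ) + 1 + (m + a)) / 2) (by linarith)
  have h3 := Real.Gamma_mul_Gamma_add_half (((m : ℝ) + 1 + (m + a)) / 2 - 1 / 4)
  have e1 : ((m : ℝ) + 1 + (m + a)) / 2 - 1 / 4 + 1 / 2 = ((m : ℝ) + 1 + (m + a)) / 2 + 1 / 4 := by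
    ring
  have e2 : 2 * (((m : ℝ) + 1 + (m + a)) / 2 - 1 / 4) = 2 * m + a + 1 / 2 := by ring
  rw [e1, e2] at h3
  rw [h3] at h2
  have hs : 1 ≤ Real.sqrt Real.pi := by
    rw [Real.one_le_sqrt]; linarith [Real.pi_gt_three]
  have hG : 0 < Real.Gamma (2 * m + a + 1 / 2) := Real.Gamma_pos_of_pos (by positivity)
  have hpos : 0 < Real.Gamma (2 * m + a + 1 / 2) * (2 : ℝ) ^ (1 - (2 * m + a + 1 / 2)) := by
    positivity
  nlinarith

lemma aux_term {a x : ℝ} (ha : 0 < a) (hx : 0 < x) (m : ℕ) :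
    x ^ (a - 1 / 2) * ((x ^ 2) ^ (m + 1) /
        (((m + 1).factorial : ℝ) * Real.Gamma (((m + 1 : ℕ) : ℝ) + a))) ≤
      3 * ((2 * x) ^ (2 * m + ⌊a + 3 / 2⌋₊ + 1) / ((2 * m + ⌊a + 3 / 2⌋₊ + 1).factorial : ℝ)
        + 2 * ((2 * x) ^ (2 * m + ⌊a + 3 / 2⌋₊) / ((2 * m + ⌊a + 3 / 2⌋₊).factorial : ℝ))) := by
  have hfl := Nat.floor_le (by linarith : 0 ≤ a + 3 / 2)
  have hfu := (Nat.lt_floor_add_one (a + 3 / 2)).le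
  set j := ⌊a + 3 / 2⌋₊
  have hE := aux_E (y := 2 * x) (b := a + 3 / 2 - j) (2 * m + j) (by positivity) (by linarith)
    (by linarith)
  have hL := aux_low ha (m + 1) (by omega)
  refine le_trans ?_ (mul_le_mul_of_nonneg_left hE (by norm_num))
  have e1 : ((2 * m + j : ℕ) : ℝ) + (a + 3 / 2 - j) = 2 * ((m + 1 : ℕ) : ℝ) + a - 1 / 2 := by
    push_cast; ring
  have e2 : ((2 * m + j : ℕ) : ℝ) + 1 + (a + 3 / 2 - j) = 2 * ((m + 1 : ℕ) : ℝ) + a + 1 / 2 := by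
    push_cast; ring
  rw [e1, e2]
  have hm : (0 : ℝ) ≤ ((m + 1 : ℕ) : ℝ) := by positivity
  generalize hM : m + 1 = M at *
  have hG : 0 < Real.Gamma (2 * (M : ℝ) + a + 1 / 2) := Real.Gamma_pos_of_pos (by positivity)
  have hG' : 0 < Real.Gamma ((M : ℝ) + a) := Real.Gamma_pos_of_pos (by positivity)
  have e3 : x ^ (a - 1 / 2) * (x ^ 2) ^ M = x ^ (2 * (M : ℝ) + a - 1 / 2) := by
    rw [← pow_mul, ← Real.rpow_natCast, ← Real.rpow_add hx]
    congr 1; push_cast; ring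
  have e4 : (2 : ℝ) ^ (1 - (2 * (M : ℝ) + a + 1 / 2)) * 2 ^ (2 * (M : ℝ) + a - 1 / 2) = 1 := by
    rw [← Real.rpow_add (by norm_num)]
    ring_nf; simp
  rw [← mul_div_assoc, e3, Real.mul_rpow (by norm_num) hx.le, ← mul_div_assoc,
    div_le_div_iff₀ (by positivity) hG]
  have hx' : 0 < x ^ (2 * (M : ℝ) + a - 1 / 2) := by positivity
  have h2 : 0 < (2 : ℝ) ^ (2 * (M : ℝ) + a - 1 / 2) := by positivity
  have := mul_le_mul_of_nonneg_left hL (mul_pos hx' h2).le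
  calc _ = x ^ (2 * (M : ℝ) + a - 1 / 2) * Real.Gamma (2 * (M : ℝ) + a + 1 / 2) *
        ((2 : ℝ) ^ (1 - (2 * (M : ℝ) + a + 1 / 2)) * 2 ^ (2 * (M : ℝ) + a - 1 / 2)) := by
        rw [e4, mul_one]
    _ = x ^ (2 * (M : ℝ) + a - 1 / 2) * 2 ^ (2 * (M : ℝ) + a - 1 / 2) *
        (Real.Gamma (2 * (M : ℝ) + a + 1 / 2) * 2 ^ (1 - (2 * (M : ℝ) + a + 1 / 2))) := by ring
    _ ≤ _ := this
    _ = _ := by ring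

lemma aux_sum (f : ℕ → ℝ) (hf : ∀ n, 0 ≤ f n) (j N : ℕ) :
    ∑ m ∈ Finset.range N, (f (2 * m + j + 1) + 2 * f (2 * m + j)) ≤
      2 * ∑ i ∈ Finset.range (j + 2 * N), f i := by
  induction N with
  | zero => simpa using Finset.sum_nonneg fun i _ => hf i
  | succ N ih =>
    have e : j + 2 * (N + 1) = 2 * N + j + 1 + 1 := by ring
    have e' : j + 2 * N = 2 * N + j := by ring
    rw [Finset.sum_range_succ, e, Finset.sum_range_succ, Finset.sum_range_succ]
    rw [e'] at ih
    linarith [hf (2 * N + j + 1)]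

/-- the zeroth term -/
lemma aux_zero (A : ℝ) (hA : 0 < A) : ∃ K : ℝ, 0 < K ∧ ∀ a x : ℝ, 0 < a → a ≤ A → 0 < x →
    x ^ (a - 1 / 2) / Real.Gamma a ≤ K * (Real.exp (2 * x) * (1 + 1 / x)) := by
  have hc : ContinuousOn Real.Gamma (Set.Icc 1 (A + 1)) := by
    intro t ht
    refine (Real.differentiableAt_Gamma fun m hm => ?_).continuousAt.continuousWithinAt
    have := ht.1
    have : (0 : ℝ) ≤ m := by positivity
    linarith
  obtain ⟨t, ht, hmin⟩ := isCompact_Icc.exists_isMinOn (Set.nonempty_Icc.2 (by linarith)) hc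
  have hg : 0 < Real.Gamma t := Real.Gamma_pos_of_pos (by linarith [ht.1])
  set N := ⌈A⌉₊
  have hN : A ≤ N := Nat.le_ceil A
  have hNf : (1 : ℝ) ≤ N.factorial := by exact_mod_cast Nat.one_le_iff_ne_zero.2 (Nat.factorial_ne_zero N)
  refine ⟨A / Real.Gamma t * N.factorial, by positivity, fun a x ha haA hx => ?_⟩
  have h1 : 1 / Real.Gamma a ≤ A / Real.Gamma t := by
    have hGa := Real.Gamma_pos_of_pos ha
    rw [div_le_div_iff₀ hGa hg]
    have h : Real.Gamma t ≤ Real.Gamma (a + 1) := hmin ⟨by linarith, by linarith⟩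
    rw [Real.Gamma_add_one ha.ne'] at h
    nlinarith
  have h2 : x ^ (a - 1 / 2) ≤ N.factorial * (Real.exp (2 * x) * (1 + 1 / x)) := by
    have hexp : 1 ≤ Real.exp (2 * x) := Real.one_le_exp (by positivity)
    rcases le_total x 1 with h | h
    · have : x ^ (a - 1 / 2) ≤ x ^ (-1 : ℝ) :=
        Real.rpow_le_rpow_of_exponent_ge hx h (by linarith)
      rw [Real.rpow_neg_one] at this
      have hi : 0 < x⁻¹ := by positivity
      rw [one_div x]
      calc _ ≤ 1 * (1 * (1 + x⁻¹)) := by linarith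
        _ ≤ _ := by gcongr
    · have : x ^ (a - 1 / 2) ≤ x ^ (N : ℝ) :=
        Real.rpow_le_rpow_of_exponent_le h (by linarith)
      rw [Real.rpow_natCast] at this
      have h3 := Real.pow_div_factorial_le_exp x hx.le N
      rw [div_le_iff₀ (by positivity)] at h3
      have h4 : Real.exp x ≤ Real.exp (2 * x) := Real.exp_le_exp.2 (by linarith)
      have hi : 0 < 1 / x := by positivity
      calc _ ≤ _ := this
        _ ≤ _ := h3
        _ = N.factorial * (Real.exp x * 1) := by ring
        _ ≤ _ := by gcongr; linarith
  calc _ = (1 / Real.Gamma a) * x ^ (a - 1 / 2) := by ring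
    _ ≤ (A / Real.Gamma t) * (N.factorial * (Real.exp (2 * x) * (1 + 1 / x))) := by gcongr
    _ = _ := by ring

/-- For every `A > 0` there exists `C = C(A) > 0` such that for every `0 < a ≤ A` and `s > 0`,
`∑_{m=0}^∞ s^m / (m! Γ(m+a)) ≤ C e^{2√s} / s^{a/2 - 1/4} · (1 + e^{C/(2√s)} / √s)`. -/
theorem stmt0 (A : ℝ) (hA : 0 < A) :
    ∃ C : ℝ, 0 < C ∧ ∀ a s : ℝ, 0 < a → a ≤ A → 0 < s →
      (∑' m : ℕ, s ^ m / ((m.factorial : ℝ) * Real.Gamma ((m : ℝ) + a))) ≤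
        C * Real.exp (2 * Real.sqrt s) / s ^ (a / 2 - 1 / 4) *
          (1 + Real.exp (C / (2 * Real.sqrt s)) / Real.sqrt s) := by
  obtain ⟨K, hK, hK0⟩ := aux_zero A hA
  refine ⟨K + 6, by positivity, fun a s ha haA hs => ?_⟩
  obtain ⟨x, hx, rfl⟩ : ∃ x : ℝ, 0 < x ∧ s = x ^ 2 :=
    ⟨Real.sqrt s, Real.sqrt_pos.2 hs, (Real.sq_sqrt hs.le).symm⟩
  rw [Real.sqrt_sq hx.le]
  have e : (x ^ 2) ^ (a / 2 - 1 / 4) = x ^ (a - 1 / 2) := by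
    rw [← Real.rpow_natCast, ← Real.rpow_mul hx.le]
    congr 1; push_cast; ring
  rw [e]
  have hxp : 0 < x ^ (a - 1 / 2) := by positivity
  have hpos : ∀ m : ℕ, 0 ≤ (x ^ 2) ^ m / ((m.factorial : ℝ) * Real.Gamma ((m : ℝ) + a)) := by
    intro m
    have := Real.Gamma_pos_of_pos (by positivity : 0 < (m : ℝ) + a)
    positivity
  have hE := Real.exp_pos (2 * x)
  have hfin : ∀ n : ℕ, x ^ (a - 1 / 2) * ∑ m ∈ Finset.range n,
      (x ^ 2) ^ m / ((m.factorial : ℝ) * Real.Gamma ((m : ℝ) + a)) ≤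
      (K + 6) * (Real.exp (2 * x) * (1 + 1 / x)) := by
    intro n
    rcases n with _ | n
    · simp; positivity
    rw [Finset.sum_range_succ', mul_add]
    have h1 := Finset.sum_le_sum fun m (_ : m ∈ Finset.range n) => aux_term ha hx m
    rw [← Finset.mul_sum, ← Finset.mul_sum] at h1
    have h2 := aux_sum (fun n => (2 * x) ^ n / (n.factorial : ℝ)) (fun n => by positivity)
      ⌊a + 3 / 2⌋₊ n
    have h3 := Real.sum_le_exp_of_nonneg (by positivity : 0 ≤ 2 * x) (⌊a + 3 / 2⌋₊ + 2 * n)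
    have h4 := hK0 a x ha haA hx
    have h5 : x ^ (a - 1 / 2) * ((x ^ 2) ^ 0 / (((0 : ℕ).factorial : ℝ) *
        Real.Gamma (((0 : ℕ) : ℝ) + a))) = x ^ (a - 1 / 2) / Real.Gamma a := by
      simp [div_eq_mul_inv]
    rw [h5]
    have h6 : 0 < Real.exp (2 * x) * (1 / x) := by positivity
    nlinarith
  have hb : ∀ n : ℕ, ∑ m ∈ Finset.range n,
      (x ^ 2) ^ m / ((m.factorial : ℝ) * Real.Gamma ((m : ℝ) + a)) ≤
      (K + 6) * Real.exp (2 * x) / x ^ (a - 1 / 2) * (1 + 1 / x) := by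
    intro n
    have := hfin n
    rw [mul_comm, ← le_div_iff₀ hxp] at this
    refine this.trans (le_of_eq ?_)
    ring
  refine (Real.tsum_le_of_sum_range_le hpos hb).trans ?_
  have : 1 ≤ Real.exp ((K + 6) / (2 * x)) := Real.one_le_exp (by positivity)
  gcongr
end

section
/- Let γ > 0 and b > 0. There exists a constant C > 0 such that for every M > 0, every continuous function f : [0,∞) → ℝ with f(y) = 0 for all y > M, and every x > 0, t > 0, one has |P_t^{γ,b} f(x)| ≤ C · ‖f‖_∞ · e^{−(x − 2√(xM))/(γt)} · (M/x)^{b/(2γ) + 1/4} · √(γt/M) · (1 + e^{Cγt/(2√(xM))} · γt/√(xM)). -/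
open MeasureTheory

/-- The semigroup `P_t^{γ,b}` (case `b > 0`):
`P_t^{γ,b} f(x) = e^{−x/(γt)} ∑_{m=0}^∞ (x/(γt))^m (1/(m! Γ(m + b/γ)))
  ∫_0^∞ e^{−z} z^{m + b/γ − 1} f(γzt) dz`. -/
noncomputable def Psem (γ b t : ℝ) (f : ℝ → ℝ) (x : ℝ) : ℝ :=
  Real.exp (-x / (γ * t)) *
    ∑' m : ℕ, (x / (γ * t)) ^ m * (1 / ((m.factorial : ℝ) * Real.Gamma ((m : ℝ) + b / γ))) *
      ∫ z in Set.Ioi (0:ℝ), Real.exp (-z) * z ^ ((m : ℝ) + b / γ - 1) * f (γ * z * t)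

/-- The supremum norm of `f` over `[0, ∞)`. -/
noncomputable def supIci (f : ℝ → ℝ) : ℝ := ⨆ y : Set.Ici (0:ℝ), |f (y : ℝ)|


/-- Lower incomplete Gamma function. -/
noncomputable def lowG (s y : ℝ) : ℝ := ∫ z in (0:ℝ)..y, Real.exp (-z) * z ^ (s - 1)

theorem lowG_ofReal (s y : ℝ) (hy : 0 ≤ y) : Complex.partialGamma (s:ℂ) y = (lowG s y : ℂ) := by
  unfold Complex.partialGamma lowG
  rw [← intervalIntegral.integral_ofReal]
  apply intervalIntegral.integral_congr
  intro z hz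
  rw [Set.uIcc_of_le hy] at hz
  simp only [Complex.ofReal_mul, Complex.ofReal_cpow hz.1]
  push_cast
  rfl

theorem lowG_add_one (s y : ℝ) (hs : 0 < s) (hy : 0 ≤ y) :
    lowG (s + 1) y = s * lowG s y - Real.exp (-y) * y ^ s := by
  have h := Complex.partialGamma_add_one (s := (s:ℂ)) (by simpa using hs) hy
  rw [show ((s:ℂ) + 1) = ((s + 1 : ℝ) : ℂ) by push_cast; rfl, lowG_ofReal _ _ hy,
    lowG_ofReal _ _ hy, ← Complex.ofReal_cpow hy] at h
  exact_mod_cast h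

theorem lowG_nonneg (s y : ℝ) (hy : 0 ≤ y) : 0 ≤ lowG s y := by
  apply intervalIntegral.integral_nonneg hy
  intro z hz
  exact mul_nonneg (Real.exp_pos _).le (Real.rpow_nonneg hz.1 _)

theorem lowG_le (s y : ℝ) (hs : 0 < s) (hy : 0 ≤ y) : lowG s y ≤ Real.Gamma s := by
  rw [Real.Gamma_eq_integral hs, lowG, intervalIntegral.integral_of_le hy]
  apply setIntegral_mono_set (Real.GammaIntegral_convergent hs)
  · filter_upwards [ae_restrict_mem measurableSet_Ioi] with z hz
    exact mul_nonneg (Real.exp_pos _).le (Real.rpow_nonneg (le_of_lt hz) _)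
  · exact Filter.Eventually.of_forall (fun z hz => hz.1)

theorem ml_eq (s y : ℝ) (hs : 0 < s) (hy : 0 ≤ y) (n : ℕ) :
    ∑ k ∈ Finset.range n, y ^ ((k:ℝ) + s) / Real.Gamma ((k:ℝ) + s + 1) =
      Real.exp y * (lowG s y / Real.Gamma s - lowG ((n:ℝ) + s) y / Real.Gamma ((n:ℝ) + s)) := by
  induction n with
  | zero => simp
  | succ n ih =>
    have hn : 0 < (n:ℝ) + s := by positivity
    have hG := Real.Gamma_pos_of_pos hn
    rw [Finset.sum_range_succ, ih,
      show ((n + 1 : ℕ) : ℝ) + s = (n:ℝ) + s + 1 by push_cast; ring,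
      lowG_add_one _ _ hn hy, Real.Gamma_add_one hn.ne', Real.exp_neg]
    have he := Real.exp_pos y
    have hG' := Real.Gamma_pos_of_pos hs
    field_simp
    ring

theorem ml_le (s y : ℝ) (hs : 0 < s) (hy : 0 ≤ y) (n : ℕ) :
    ∑ k ∈ Finset.range n, y ^ ((k:ℝ) + s) / Real.Gamma ((k:ℝ) + s + 1) ≤ Real.exp y := by
  rw [ml_eq s y hs hy]
  have hn : 0 < (n:ℝ) + s := by positivity
  have h1 : lowG s y / Real.Gamma s ≤ 1 :=
    (div_le_one (Real.Gamma_pos_of_pos hs)).2 (lowG_le s y hs hy)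
  have h2 : 0 ≤ lowG ((n:ℝ) + s) y / Real.Gamma ((n:ℝ) + s) :=
    div_nonneg (lowG_nonneg _ _ hy) (Real.Gamma_pos_of_pos hn).le
  nlinarith [Real.exp_pos y]

theorem Gamma_mid (p q : ℝ) (hp : 0 < p) (hq : 0 < q) :
    Real.Gamma ((p + q) / 2) ^ 2 ≤ Real.Gamma p * Real.Gamma q := by
  have h := Real.Gamma_mul_add_mul_le_rpow_Gamma_mul_rpow_Gamma hp hq
    (show (0:ℝ) < 1/2 by norm_num) (show (0:ℝ) < 1/2 by norm_num) (by norm_num)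
  rw [← Real.sqrt_eq_rpow, ← Real.sqrt_eq_rpow, show 1/2*p + 1/2*q = (p+q)/2 by ring] at h
  have hp' := (Real.Gamma_pos_of_pos hp).le
  have hq' := (Real.Gamma_pos_of_pos hq).le
  calc _ ≤ (√(Real.Gamma p) * √(Real.Gamma q)) ^ 2 := by
        apply pow_le_pow_left₀ (Real.Gamma_pos_of_pos (by positivity)).le h
    _ = _ := by rw [mul_pow, Real.sq_sqrt hp', Real.sq_sqrt hq']

theorem gamma_prod (s : ℝ) (hs : 0 < s) (m : ℕ) :
    √((m:ℝ) + s / 2) * ((2:ℝ) ^ (-(2 * (m:ℝ) + s)) * Real.Gamma (2 * (m:ℝ) + s + 1)) ≤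
      (m.factorial : ℝ) * Real.Gamma ((m:ℝ) + s + 1) := by
  obtain ⟨c, hc⟩ : ∃ c, c = (m:ℝ) + s / 2 := ⟨_, rfl⟩
  have hc0 : 0 < c := by rw [hc]; positivity
  have h1 := Gamma_mid ((m:ℝ) + 1) ((m:ℝ) + s + 1) (by positivity) (by positivity)
  rw [Real.Gamma_nat_eq_factorial, show ((m:ℝ) + 1 + ((m:ℝ) + s + 1)) / 2 = c + 1 by
    rw [hc]; ring] at h1
  refine le_trans ?_ h1
  have h2 := Gamma_mid c (c + 1) hc0 (by positivity)
  rw [Real.Gamma_add_one hc0.ne', show (c + (c+1))/2 = c + 1/2 by ring] at h2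
  have hG := Real.Gamma_pos_of_pos hc0
  have hG2 := Real.Gamma_pos_of_pos (show 0 < c + 1/2 by positivity)
  have h3 : √c * Real.Gamma (c + 1/2) ≤ Real.Gamma (c + 1) := by
    rw [Real.Gamma_add_one hc0.ne']
    apply le_of_sq_le_sq _ (by positivity)
    rw [mul_pow, Real.sq_sqrt hc0.le]
    nlinarith
  have h4 := Real.Gamma_mul_Gamma_add_half (c + 1/2)
  rw [show c + 1/2 + 1/2 = c + 1 by ring, show 2 * (c + 1/2) = 2 * c + 1 by ring,
    show 1 - (2 * c + 1) = -(2*c) by ring] at h4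
  rw [← hc, show 2 * (m:ℝ) + s = 2 * c by rw [hc]; ring]
  have hG3 := Real.Gamma_pos_of_pos (show 0 < 2 * c + 1 by positivity)
  have hpi : 1 ≤ √Real.pi := by
    rw [Real.one_le_sqrt]; linarith [Real.pi_gt_three]
  have hw : 0 < Real.Gamma (2 * c + 1) * (2:ℝ) ^ (-(2*c)) := by positivity
  have hs0 : 0 < √c := Real.sqrt_pos.2 hc0
  have hG4 : 0 < Real.Gamma (c + 1) := Real.Gamma_pos_of_pos (by positivity)
  calc √c * ((2:ℝ) ^ (-(2*c)) * Real.Gamma (2 * c + 1))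
      ≤ √c * (Real.Gamma (2 * c + 1) * (2:ℝ) ^ (-(2*c)) * √Real.pi) := by
        apply mul_le_mul_of_nonneg_left _ hs0.le
        nlinarith
    _ = (√c * Real.Gamma (c + 1/2)) * Real.Gamma (c+1) := by rw [← h4]; ring
    _ ≤ _ := by rw [sq]; exact mul_le_mul_of_nonneg_right h3 hG4.le

theorem term_le (s u : ℝ) (hs : 0 < s) (hu : 0 < u) (m : ℕ) :
    √(2 * u) * (u ^ (2 * (m:ℝ) + s) / ((m.factorial : ℝ) * Real.Gamma ((m:ℝ) + s + 1))) ≤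
      (1 + 1 / s) * ((2 * u) ^ (((2 * m : ℕ):ℝ) + s) / Real.Gamma (((2 * m : ℕ):ℝ) + s + 1) +
        (2 * u) ^ (((2 * m + 1 : ℕ):ℝ) + s) / Real.Gamma (((2 * m + 1 : ℕ):ℝ) + s + 1)) := by
  have hp := gamma_prod s hs m
  obtain ⟨c, hc⟩ : ∃ c, c = (m:ℝ) + s / 2 := ⟨_, rfl⟩
  have hc0 : 0 < c := by rw [hc]; positivity
  rw [show (((2 * m : ℕ):ℝ) + s) = 2 * c by rw [hc]; push_cast; ring,
    show (((2 * m + 1 : ℕ):ℝ) + s) = 2 * c + 1 by rw [hc]; push_cast; ring]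
  rw [← hc, show 2 * (m:ℝ) + s = 2 * c by rw [hc]; ring] at hp
  rw [show 2 * (m:ℝ) + s = 2 * c by rw [hc]; ring]
  have hG3 := Real.Gamma_pos_of_pos (show 0 < 2 * c + 1 by positivity)
  have hs0 : 0 < √c := Real.sqrt_pos.2 hc0
  obtain ⟨y, hy⟩ : ∃ y, y = 2 * u := ⟨_, rfl⟩
  have hy0 : 0 < y := by rw [hy]; positivity
  have hum : y ^ (2 * c) = 2 ^ (2 * c) * u ^ (2 * c) := by
    rw [hy, Real.mul_rpow (by norm_num) hu.le]
  have h2 : (0:ℝ) < 2 ^ (2 * c) := by positivity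
  have hup : 0 < u ^ (2 * c) := by positivity
  rw [← hy, Real.rpow_add_one hy0.ne', Real.Gamma_add_one (show 2 * c + 1 ≠ 0 by positivity)]
  have hcs : s / 2 ≤ c := by rw [hc]; linarith [(Nat.cast_nonneg m : (0:ℝ) ≤ m)]
  have key : √y / √c ≤ (1 + 1 / s) * (1 + y / (2 * c + 1)) := by
    have e1 : √y / √c = √(y / c) := (Real.sqrt_div hy0.le c).symm
    have e2 : √(y / c) ≤ 1 + (y / c) / 2 := by
      have := Real.sq_sqrt (show 0 ≤ y / c by positivity)
      nlinarith [sq_nonneg (√(y/c) - 1)]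
    have e3 : (y / c) / 2 ≤ (1 + 1/s) * (y / (2 * c + 1)) := by
      rw [show (1 + 1/s) * (y / (2 * c + 1)) = y * (s + 1) / (s * (2 * c + 1)) by field_simp,
        div_div, div_le_div_iff₀ (by positivity) (by positivity)]
      nlinarith
    have e4 : 0 < 1 / s := by positivity
    rw [e1]; nlinarith
  calc √y * (u ^ (2 * c) / ((m.factorial : ℝ) * Real.Gamma ((m:ℝ) + s + 1)))
      ≤ √y * (u ^ (2 * c) / (√c * ((2:ℝ) ^ (-(2 * c)) * Real.Gamma (2 * c + 1)))) := by
        gcongr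
    _ = √y / √c * (y ^ (2 * c) / Real.Gamma (2 * c + 1)) := by
        rw [hum, Real.rpow_neg (by norm_num)]; field_simp
    _ ≤ (1 + 1 / s) * (1 + y / (2 * c + 1)) * (y ^ (2 * c) / Real.Gamma (2 * c + 1)) := by
        gcongr
    _ = _ := by field_simp

theorem bessel_le (s u : ℝ) (hs : 0 < s) (hu : 0 < u) (n : ℕ) :
    √(2 * u) * ∑ m ∈ Finset.range n,
      (u ^ (2 * (m:ℝ) + s) / ((m.factorial : ℝ) * Real.Gamma ((m:ℝ) + s + 1))) ≤
      (1 + 1 / s) * Real.exp (2 * u) := by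
  have h0 : 0 < 1 + 1 / s := by positivity
  refine le_trans ?_ (mul_le_mul_of_nonneg_left
    (ml_le s (2 * u) hs (by positivity) (2 * n)) h0.le)
  rw [Finset.mul_sum]
  refine le_trans (Finset.sum_le_sum (fun m _ => term_le s u hs hu m)) ?_
  rw [← Finset.mul_sum]
  apply le_of_eq
  congr 1
  clear h0
  induction n with
  | zero => simp
  | succ n ih =>
    rw [Finset.sum_range_succ, ih, show 2 * (n + 1) = 2 * n + 1 + 1 by ring,
      Finset.sum_range_succ, Finset.sum_range_succ]
    ring

theorem le_supIci (M : ℝ) (hM : 0 < M) (f : ℝ → ℝ) (hf : ContinuousOn f (Set.Ici 0))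
    (hz : ∀ y > M, f y = 0) (y : ℝ) (hy : 0 ≤ y) : |f y| ≤ supIci f := by
  obtain ⟨B, hB⟩ := (isCompact_Icc (a := (0:ℝ)) (b := M)).exists_bound_of_continuousOn
    (hf.mono (fun z hz => hz.1))
  have hbdd : BddAbove (Set.range (fun y : Set.Ici (0:ℝ) => |f (y : ℝ)|)) := by
    refine ⟨B, ?_⟩
    rintro _ ⟨⟨z, hz0⟩, rfl⟩
    by_cases h : z ≤ M
    · exact hB z ⟨hz0, h⟩
    · simp only [hz z (not_le.1 h), abs_zero]
      exact le_trans (norm_nonneg _) (hB 0 ⟨le_refl _, hM.le⟩)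
  exact le_ciSup hbdd ⟨y, hy⟩

theorem int_le (s N F p : ℝ) (hp : 0 < p) (hN : 0 < N) (hs : 0 < s) (g : ℝ → ℝ)
    (hg : ∀ z > 0, |g z| ≤ F) (hg0 : ∀ z > N, g z = 0) :
    |∫ z in Set.Ioi (0:ℝ), Real.exp (-z) * z ^ (p - 1) * g z| ≤ F * (N ^ p / p) := by
  have hF : 0 ≤ F := le_trans (abs_nonneg _) (hg 1 one_pos)
  have hint : IntervalIntegrable (fun z : ℝ => z ^ (p - 1)) volume 0 N :=
    intervalIntegral.intervalIntegrable_rpow' (by linarith)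
  have hint' : IntegrableOn (fun z : ℝ => F * z ^ (p - 1)) (Set.Ioc 0 N) :=
    ((intervalIntegrable_iff_integrableOn_Ioc_of_le hN.le).1 hint).const_mul F
  have hval : ∫ z in Set.Ioc (0:ℝ) N, F * z ^ (p - 1) = F * (N ^ p / p) := by
    rw [← intervalIntegral.integral_of_le hN.le, intervalIntegral.integral_const_mul,
      integral_rpow (Or.inl (by linarith))]
    rw [sub_add_cancel, Real.zero_rpow hp.ne', sub_zero]
  have h := norm_integral_le_of_norm_le (μ := volume.restrict (Set.Ioi (0:ℝ)))
    (f := fun z => Real.exp (-z) * z ^ (p - 1) * g z)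
    (g := (Set.Ioc (0:ℝ) N).indicator (fun z => F * z ^ (p - 1)))
    (((integrable_indicator_iff measurableSet_Ioc).2 hint').mono_measure
      Measure.restrict_le_self) ?_
  · rw [Real.norm_eq_abs, setIntegral_indicator measurableSet_Ioc,
      Set.inter_eq_self_of_subset_right Set.Ioc_subset_Ioi_self, hval] at h
    exact h
  · filter_upwards [ae_restrict_mem measurableSet_Ioi] with z hz
    have hz : 0 < z := hz
    by_cases h : z ≤ N
    · rw [Set.indicator_of_mem (show z ∈ Set.Ioc (0:ℝ) N from ⟨hz, h⟩), Real.norm_eq_abs,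
        abs_mul, abs_of_nonneg (by positivity : 0 ≤ Real.exp (-z) * z ^ (p-1)), mul_comm F]
      have h1 : Real.exp (-z) ≤ 1 := Real.exp_le_one_iff.2 (by linarith)
      have h2 : 0 ≤ z ^ (p - 1) := by positivity
      have h3 : Real.exp (-z) * z ^ (p-1) ≤ z ^ (p - 1) := mul_le_of_le_one_left h2 h1
      exact mul_le_mul h3 (hg z hz) (abs_nonneg _) h2
    · rw [hg0 z (not_le.1 h), Set.indicator_of_notMem (fun hh => h hh.2)]
      simp

theorem series_le (s X N : ℝ) (hs : 0 < s) (hX : 0 < X) (hN : 0 < N) (n : ℕ) :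
    ∑ m ∈ Finset.range n, X ^ m * (1 / ((m.factorial : ℝ) * Real.Gamma ((m : ℝ) + s))) *
      (N ^ ((m:ℝ) + s) / ((m:ℝ) + s)) ≤
    (1 + 1 / s) * (Real.exp (2 * √(X * N)) * (N / X) ^ (s / 2 + 1 / 4) * √(1 / N)) := by
  have hu : 0 < √(X * N) := Real.sqrt_pos.2 (by positivity)
  obtain ⟨u, hud⟩ : ∃ u, u = √(X * N) := ⟨_, rfl⟩
  rw [← hud] at hu ⊢
  have hr : 0 < √(2 * u) := Real.sqrt_pos.2 (by positivity)
  have h := bessel_le s u hs hu n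
  have hterm : ∀ m : ℕ, X ^ m * (1 / ((m.factorial : ℝ) * Real.Gamma ((m : ℝ) + s))) *
      (N ^ ((m:ℝ) + s) / ((m:ℝ) + s)) = (N / X) ^ (s / 2) *
      (u ^ (2 * (m:ℝ) + s) / ((m.factorial : ℝ) * Real.Gamma ((m:ℝ) + s + 1))) := by
    intro m
    have hm : 0 < (m:ℝ) + s := by positivity
    have hG := Real.Gamma_pos_of_pos hm
    rw [Real.Gamma_add_one hm.ne']
    have : (N / X) ^ (s / 2) * u ^ (2 * (m:ℝ) + s) = X ^ m * N ^ ((m:ℝ) + s) := by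
      rw [hud, Real.sqrt_eq_rpow, ← Real.rpow_mul (by positivity), Real.div_rpow hN.le hX.le,
        Real.mul_rpow hX.le hN.le, ← Real.rpow_natCast X m]
      rw [show 1 / 2 * (2 * (m:ℝ) + s) = m + s/2 by ring, Real.rpow_add hX,
        show (m:ℝ) + s = s / 2 + (m + s/2) by ring, Real.rpow_add hN (s/2)]
      have : 0 < X ^ (s/2) := by positivity
      field_simp
    rw [← mul_div_assoc ((N / X) ^ (s / 2)), this]
    field_simp
  simp only [hterm]
  rw [← Finset.mul_sum]
  have hq : (N / X) ^ (s / 2 + 1 / 4) * √(1 / N) = (N / X) ^ (s / 2) / √u := by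
    rw [Real.rpow_add (by positivity), hud]
    rw [Real.sqrt_eq_rpow, Real.sqrt_eq_rpow, Real.sqrt_eq_rpow, ← Real.rpow_mul (by positivity)]
    rw [Real.div_rpow hN.le hX.le (1/4), Real.div_rpow zero_le_one hN.le, Real.mul_rpow hX.le hN.le,
      Real.one_rpow, show (1:ℝ)/2 = 1/4 + 1/4 by norm_num, Real.rpow_add hN,
      show ((1:ℝ)/4 + 1/4) * (1/4 + 1/4) = 1/4 by norm_num]
    have h1 : 0 < N ^ ((1:ℝ)/4) := by positivity
    have h2 : 0 < X ^ ((1:ℝ)/4) := by positivity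
    field_simp
  rw [mul_assoc (Real.exp _), hq]
  have hru : 0 < √u := Real.sqrt_pos.2 hu
  have hle : √u ≤ √(2 * u) := Real.sqrt_le_sqrt (by linarith)
  obtain ⟨S, hS⟩ : ∃ S, S = ∑ m ∈ Finset.range n,
      (u ^ (2 * (m:ℝ) + s) / ((m.factorial : ℝ) * Real.Gamma ((m:ℝ) + s + 1))) := ⟨_, rfl⟩
  have hS0 : 0 ≤ S := by
    rw [hS]; apply Finset.sum_nonneg; intro m _
    have := Real.Gamma_pos_of_pos (show 0 < (m:ℝ) + s + 1 by positivity)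
    positivity
  rw [← hS] at h ⊢
  have h5 : S ≤ (1 + 1 / s) * Real.exp (2 * u) / √u := by
    rw [le_div_iff₀ hru]; nlinarith
  calc _ ≤ (N / X) ^ (s / 2) * ((1 + 1 / s) * Real.exp (2 * u) / √u) := by gcongr
    _ = _ := by ring

theorem abs_tsum_le (a : ℕ → ℝ) (B : ℝ) (h : ∀ n, ∑ m ∈ Finset.range n, |a m| ≤ B) :
    |∑' m, a m| ≤ B := by
  have hsum : Summable (fun m => ‖a m‖) :=
    summable_of_sum_range_le (fun m => norm_nonneg _) h
  exact le_trans (norm_tsum_le_tsum_norm hsum)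
    (Real.tsum_le_of_sum_range_le (fun m => norm_nonneg _) h)

/-- Let `γ > 0`, `b > 0`. There is `C > 0` such that for every `M > 0`, every continuous
`f : [0,∞) → ℝ` vanishing on `(M,∞)`, and every `x > 0`, `t > 0`:
`|P_t^{γ,b} f(x)| ≤ C ‖f‖_∞ e^{−(x − 2√(xM))/(γt)} (M/x)^{b/(2γ)+1/4} √(γt/M)
  (1 + e^{Cγt/(2√(xM))} γt/√(xM))`. -/
theorem stmt10 (γ b : ℝ) (hγ : 0 < γ) (hb : 0 < b) :
    ∃ C > (0:ℝ), ∀ M > (0:ℝ), ∀ f : ℝ → ℝ, ContinuousOn f (Set.Ici 0) →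
      (∀ y > M, f y = 0) → ∀ x > (0:ℝ), ∀ t > (0:ℝ),
      |Psem γ b t f x| ≤
        C * supIci f * Real.exp (-(x - 2 * Real.sqrt (x * M)) / (γ * t)) *
          (M / x) ^ (b / (2 * γ) + 1 / 4) * Real.sqrt (γ * t / M) *
            (1 + Real.exp (C * γ * t / (2 * Real.sqrt (x * M))) *
              (γ * t / Real.sqrt (x * M))) := by
  have hs : 0 < b / γ := by positivity
  have hC : 0 < 1 + 1 / (b / γ) := by positivity
  refine ⟨1 + 1 / (b / γ), hC, ?_⟩
  intro M hM f hf hz x hx t ht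
  have hgt : 0 < γ * t := by positivity
  have hsup := le_supIci M hM f hf hz
  have hF : 0 ≤ supIci f := le_trans (abs_nonneg _) (hsup 0 le_rfl)
  have hX : 0 < x / (γ * t) := by positivity
  have hN : 0 < M / (γ * t) := by positivity
  have hser := series_le (b / γ) (x / (γ * t)) (M / (γ * t)) hs hX hN
  have hsq : √(x / (γ * t) * (M / (γ * t))) = √(x * M) / (γ * t) := by
    rw [div_mul_div_comm, Real.sqrt_div (by positivity), Real.sqrt_mul_self hgt.le]
  rw [hsq, div_div_div_cancel_right₀ hgt.ne', one_div_div M (γ * t),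
    show b / γ / 2 = b / (2 * γ) by field_simp] at hser
  have hterm : ∀ m : ℕ, |(x / (γ * t)) ^ m *
      (1 / ((m.factorial : ℝ) * Real.Gamma ((m : ℝ) + b / γ))) *
      ∫ z in Set.Ioi (0:ℝ), Real.exp (-z) * z ^ ((m : ℝ) + b / γ - 1) * f (γ * z * t)| ≤
      supIci f * ((x / (γ * t)) ^ m * (1 / ((m.factorial : ℝ) * Real.Gamma ((m : ℝ) + b / γ))) *
      ((M / (γ * t)) ^ ((m:ℝ) + b / γ) / ((m:ℝ) + b / γ))) := by
    intro m
    have hm : 0 < (m:ℝ) + b / γ := by positivity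
    have hG := Real.Gamma_pos_of_pos hm
    have h := int_le (b / γ) (M / (γ * t)) (supIci f) ((m:ℝ) + b / γ) hm hN hs
      (fun z => f (γ * z * t)) (fun z hz0 => hsup _ (by have : 0 < z := hz0; positivity))
      (fun z hz0 => hz _ (by
        have h1 : M / (γ * t) < z := hz0
        rw [div_lt_iff₀ hgt] at h1
        show M < γ * z * t
        linarith))
    have h0 : 0 ≤ (x / (γ * t)) ^ m * (1 / ((m.factorial : ℝ) * Real.Gamma ((m : ℝ) + b / γ))) := by
      positivity
    rw [abs_mul, abs_of_nonneg h0]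
    refine le_trans (mul_le_mul_of_nonneg_left h h0) (le_of_eq (by ring))
  have htsum : |∑' m : ℕ, (x / (γ * t)) ^ m *
      (1 / ((m.factorial : ℝ) * Real.Gamma ((m : ℝ) + b / γ))) *
      ∫ z in Set.Ioi (0:ℝ), Real.exp (-z) * z ^ ((m : ℝ) + b / γ - 1) * f (γ * z * t)| ≤
      supIci f * ((1 + 1 / (b / γ)) * (Real.exp (2 * (√(x * M) / (γ * t))) *
        (M / x) ^ (b / (2 * γ) + 1 / 4) * √(γ * t / M))) := by
    have hpart : ∀ n : ℕ, ∑ m ∈ Finset.range n, |(x / (γ * t)) ^ m *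
      (1 / ((m.factorial : ℝ) * Real.Gamma ((m : ℝ) + b / γ))) *
      ∫ z in Set.Ioi (0:ℝ), Real.exp (-z) * z ^ ((m : ℝ) + b / γ - 1) * f (γ * z * t)| ≤
      supIci f * ((1 + 1 / (b / γ)) * (Real.exp (2 * (√(x * M) / (γ * t))) *
        (M / x) ^ (b / (2 * γ) + 1 / 4) * √(γ * t / M))) := by
      intro n
      refine le_trans (Finset.sum_le_sum (fun m _ => hterm m)) ?_
      rw [← Finset.mul_sum]
      exact mul_le_mul_of_nonneg_left (hser n) hF
    exact abs_tsum_le _ _ hpart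
  unfold Psem
  rw [abs_mul, abs_of_pos (Real.exp_pos _)]
  refine le_trans (mul_le_mul_of_nonneg_left htsum (Real.exp_pos _).le) ?_
  have hexp : Real.exp (-(x - 2 * √(x * M)) / (γ * t)) =
      Real.exp (-x / (γ * t)) * Real.exp (2 * (√(x * M) / (γ * t))) := by
    rw [← Real.exp_add]; congr 1; ring
  rw [hexp]
  have hone : (1:ℝ) ≤ 1 + Real.exp ((1 + 1 / (b / γ)) * γ * t / (2 * √(x * M))) *
      (γ * t / √(x * M)) := by
    have : 0 ≤ Real.exp ((1 + 1 / (b / γ)) * γ * t / (2 * √(x * M))) *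
      (γ * t / √(x * M)) := by positivity
    linarith
  refine le_trans (le_of_eq ?_) (le_mul_of_one_le_right (by positivity) hone)
  ring
end

section
/- Let γ > 0 and b > 0. Let f : [0,∞) → ℝ be twice continuously differentiable with f, f', f'' bounded, and suppose there exists K > 0 such that f is constant on [K,∞). Then lim_{t → 0⁺} sup_{x ≥ 0} | (P_t^{γ,b} f(x) − f(x))/t − (γ x f''(x) + b f'(x)) | = 0. -/
open MeasureTheory

lemma aux_hs {u v : ℕ → ℝ} {a c : ℝ} (h : HasSum u a) (h1 : ∀ m, v m = u m) (h2 : c = a) :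
    HasSum v c := by
  have : v = u := funext h1
  rw [this, h2]; exact h

lemma aux_poisson (l : ℝ) (k : ℕ) :
    HasSum (fun m : ℕ => l ^ m / (m.factorial : ℝ) * (m.descFactorial k : ℝ)) (Real.exp l * l ^ k) := by
  have h := NormedSpace.expSeries_div_hasSum_exp (𝔸 := ℝ) l
  rw [← Real.exp_eq_exp_ℝ] at h
  have h2 := h.mul_right (l ^ k)
  rw [← hasSum_nat_add_iff' k]
  have : ∑ i ∈ Finset.range k, l ^ i / (i.factorial : ℝ) * (i.descFactorial k : ℝ) = 0 := by
    apply Finset.sum_eq_zero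
    intro i hi
    rw [Nat.descFactorial_of_lt (Finset.mem_range.1 hi)]; simp
  rw [this, sub_zero]
  refine aux_hs h2 (fun m => ?_) rfl
  have e := Nat.factorial_mul_descFactorial (Nat.le_add_left k m)
  rw [Nat.add_sub_cancel] at e
  have e' : ((m + k).factorial : ℝ) = m.factorial * ((m + k).descFactorial k : ℝ) := by
    exact_mod_cast e.symm
  have h1 : (m.factorial : ℝ) ≠ 0 := by positivity
  have h3 : ((m + k).factorial : ℝ) ≠ 0 := by positivity
  rw [e'] at h3 ⊢
  have h4 := right_ne_zero_of_mul h3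
  field_simp
  ring

lemma aux_gamma (a : ℝ) (ha : 0 < a) (k : ℕ) :
    IntegrableOn (fun z : ℝ => Real.exp (-z) * z ^ (a - 1) * z ^ k) (Set.Ioi 0) ∧
    ∫ z in Set.Ioi (0:ℝ), Real.exp (-z) * z ^ (a - 1) * z ^ k = Real.Gamma (a + k) := by
  have hk : 0 < a + k := by positivity
  have e : Set.EqOn (fun z : ℝ => Real.exp (-z) * z ^ (a + k - 1))
      (fun z : ℝ => Real.exp (-z) * z ^ (a - 1) * z ^ k) (Set.Ioi 0) := by
    intro z hz
    simp only
    rw [mul_assoc, ← Real.rpow_natCast z k, ← Real.rpow_add hz]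
    congr 2; ring
  refine ⟨(Real.GammaIntegral_convergent hk).congr_fun e measurableSet_Ioi, ?_⟩
  rw [Real.Gamma_eq_integral hk]
  exact (setIntegral_congr_fun measurableSet_Ioi e).symm

lemma aux_poly (a : ℝ) (ha : 0 < a) (c0 c1 c2 c3 c4 : ℝ) :
    IntegrableOn (fun z : ℝ => Real.exp (-z) * z ^ (a - 1) *
      (c0 + c1 * z + c2 * z ^ 2 + c3 * z ^ 3 + c4 * z ^ 4)) (Set.Ioi 0) ∧
    ∫ z in Set.Ioi (0:ℝ), Real.exp (-z) * z ^ (a - 1) *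
      (c0 + c1 * z + c2 * z ^ 2 + c3 * z ^ 3 + c4 * z ^ 4) =
    Real.Gamma a * (c0 + c1 * a + c2 * (a * (a + 1)) + c3 * (a * (a + 1) * (a + 2))
      + c4 * (a * (a + 1) * (a + 2) * (a + 3))) := by
  obtain ⟨i0, h0⟩ := aux_gamma a ha 0
  obtain ⟨i1, h1⟩ := aux_gamma a ha 1
  obtain ⟨i2, h2⟩ := aux_gamma a ha 2
  obtain ⟨i3, h3⟩ := aux_gamma a ha 3
  obtain ⟨i4, h4⟩ := aux_gamma a ha 4
  have g1 : Real.Gamma (a + 1) = a * Real.Gamma a := Real.Gamma_add_one ha.ne'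
  have g2 : Real.Gamma (a + 2) = (a + 1) * (a * Real.Gamma a) := by
    rw [← g1, ← Real.Gamma_add_one (by positivity)]; congr 1; ring
  have g3 : Real.Gamma (a + 3) = (a + 2) * ((a + 1) * (a * Real.Gamma a)) := by
    rw [← g2, ← Real.Gamma_add_one (by positivity)]; congr 1; ring
  have g4 : Real.Gamma (a + 4) = (a + 3) * ((a + 2) * ((a + 1) * (a * Real.Gamma a))) := by
    rw [← g3, ← Real.Gamma_add_one (by positivity)]; congr 1; ring
  have e : (fun z : ℝ => Real.exp (-z) * z ^ (a - 1) *
      (c0 + c1 * z + c2 * z ^ 2 + c3 * z ^ 3 + c4 * z ^ 4)) =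
      fun z : ℝ => c0 * (Real.exp (-z) * z ^ (a - 1) * z ^ 0)
       + c1 * (Real.exp (-z) * z ^ (a - 1) * z ^ 1)
       + c2 * (Real.exp (-z) * z ^ (a - 1) * z ^ 2)
       + c3 * (Real.exp (-z) * z ^ (a - 1) * z ^ 3)
       + c4 * (Real.exp (-z) * z ^ (a - 1) * z ^ 4) := by
    funext z; ring
  have j0 := i0.const_mul c0
  have j1 := j0.add (i1.const_mul c1)
  have j2 := j1.add (i2.const_mul c2)
  have j3 := j2.add (i3.const_mul c3)
  have j4 := j3.add (i4.const_mul c4)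
  rw [e]
  refine ⟨j4, ?_⟩
  have s4 := integral_add j3 (i4.const_mul c4)
  have s3 := integral_add j2 (i3.const_mul c3)
  have s2 := integral_add j1 (i2.const_mul c2)
  have s1 := integral_add j0 (i1.const_mul c1)
  simp only [Pi.add_apply] at s1 s2 s3 s4
  rw [s4, s3, s2, s1]
  simp only [integral_const_mul]
  rw [h0, h1, h2, h3, h4]
  push_cast
  rw [g1, g2, g3, g4, add_zero]
  ring

lemma aux_desc (m : ℕ) : (m.descFactorial 0 : ℝ) = 1 ∧ (m.descFactorial 1 : ℝ) = m ∧
    (m.descFactorial 2 : ℝ) = m * (m - 1) ∧ (m.descFactorial 3 : ℝ) = m * (m - 1) * (m - 2) ∧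
    (m.descFactorial 4 : ℝ) = m * (m - 1) * (m - 2) * (m - 3) := by
  refine ⟨by simp, by simp, ?_, ?_, ?_⟩ <;>
  · rw [Nat.cast_descFactorial]
    simp [ascPochhammer]
    rcases m with _ | _ | _ | _ | m <;> simp <;> ring

/-- polynomial moments -/
lemma aux_moment (l β : ℝ) (hβ : 0 < β) (c0 c1 c2 c3 c4 : ℝ) :
    HasSum (fun m : ℕ => l ^ m * (1 / ((m.factorial : ℝ) * Real.Gamma ((m : ℝ) + β))) *
      ∫ z in Set.Ioi (0:ℝ), Real.exp (-z) * z ^ ((m : ℝ) + β - 1) *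
        (c0 + c1 * z + c2 * z ^ 2 + c3 * z ^ 3 + c4 * z ^ 4))
    (Real.exp l * (c0 + c1 * (l + β) + c2 * (l ^ 2 + 2 * l * (β + 1) + β * (β + 1))
      + c3 * (l ^ 3 + 3 * l ^ 2 * (β + 2) + 3 * l * (β + 1) * (β + 2) + β * (β + 1) * (β + 2))
      + c4 * (l ^ 4 + 4 * l ^ 3 * (β + 3) + 6 * l ^ 2 * (β + 2) * (β + 3)
          + 4 * l * (β + 1) * (β + 2) * (β + 3) + β * (β + 1) * (β + 2) * (β + 3)))) := by
  have p0 := aux_poisson l 0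
  have p1 := aux_poisson l 1
  have p2 := aux_poisson l 2
  have p3 := aux_poisson l 3
  have p4 := aux_poisson l 4
  have s := ((((p0.mul_left (c0 + c1 * β + c2 * (β * (β + 1)) + c3 * (β * (β + 1) * (β + 2))
      + c4 * (β * (β + 1) * (β + 2) * (β + 3)))).add
    (p1.mul_left (c1 + c2 * (2 * (β + 1)) + c3 * (3 * (β + 1) * (β + 2))
      + c4 * (4 * (β + 1) * (β + 2) * (β + 3))))).add
    (p2.mul_left (c2 + c3 * (3 * (β + 2)) + c4 * (6 * (β + 2) * (β + 3))))).add
    (p3.mul_left (c3 + c4 * (4 * (β + 3))))).add (p4.mul_left c4)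
  refine aux_hs s (fun m => ?_) ?_
  · have ha : 0 < (m : ℝ) + β := by positivity
    rw [(aux_poly _ ha c0 c1 c2 c3 c4).2]
    obtain ⟨d0, d1, d2, d3, d4⟩ := aux_desc m
    rw [d0, d1, d2, d3, d4]
    have hG := (Real.Gamma_pos_of_pos ha).ne'
    have hF : (m.factorial : ℝ) ≠ 0 := by positivity
    field_simp
    ring
  · ring

lemma aux_transfer (l β : ℝ) (hl : 0 ≤ l) (hβ : 0 < β) (g : ℝ → ℝ)
    (hg : ContinuousOn g (Set.Ioi 0)) (c0 c1 c2 d0 d1 d2 d3 d4 : ℝ)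
    (hle : ∀ z > 0, |g z - (c0 + c1 * z + c2 * z ^ 2)| ≤
      d0 + d1 * z + d2 * z ^ 2 + d3 * z ^ 3 + d4 * z ^ 4) :
    |Real.exp (-l) * (∑' m : ℕ, l ^ m * (1 / ((m.factorial : ℝ) * Real.Gamma ((m : ℝ) + β))) *
      ∫ z in Set.Ioi (0:ℝ), Real.exp (-z) * z ^ ((m : ℝ) + β - 1) * g z) -
      (c0 + c1 * (l + β) + c2 * (l ^ 2 + 2 * l * (β + 1) + β * (β + 1)))| ≤
    d0 + d1 * (l + β) + d2 * (l ^ 2 + 2 * l * (β + 1) + β * (β + 1))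
      + d3 * (l ^ 3 + 3 * l ^ 2 * (β + 2) + 3 * l * (β + 1) * (β + 2) + β * (β + 1) * (β + 2))
      + d4 * (l ^ 4 + 4 * l ^ 3 * (β + 3) + 6 * l ^ 2 * (β + 2) * (β + 3)
          + 4 * l * (β + 1) * (β + 2) * (β + 3) + β * (β + 1) * (β + 2) * (β + 3)) := by
  have hp := aux_moment l β hβ c0 c1 c2 0 0
  have hq := aux_moment l β hβ d0 d1 d2 d3 d4
  simp only [zero_mul, add_zero] at hp
  have key : ∀ m : ℕ,
      ‖l ^ m * (1 / ((m.factorial : ℝ) * Real.Gamma ((m : ℝ) + β))) *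
        (∫ z in Set.Ioi (0:ℝ), Real.exp (-z) * z ^ ((m : ℝ) + β - 1) * g z) -
      l ^ m * (1 / ((m.factorial : ℝ) * Real.Gamma ((m : ℝ) + β))) *
        (∫ z in Set.Ioi (0:ℝ), Real.exp (-z) * z ^ ((m : ℝ) + β - 1) *
          (c0 + c1 * z + c2 * z ^ 2))‖ ≤
      l ^ m * (1 / ((m.factorial : ℝ) * Real.Gamma ((m : ℝ) + β))) *
        ∫ z in Set.Ioi (0:ℝ), Real.exp (-z) * z ^ ((m : ℝ) + β - 1) *
          (d0 + d1 * z + d2 * z ^ 2 + d3 * z ^ 3 + d4 * z ^ 4) := by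
    intro m
    have ha : 0 < (m : ℝ) + β := by positivity
    have hG := Real.Gamma_pos_of_pos ha
    have hw : 0 ≤ l ^ m * (1 / ((m.factorial : ℝ) * Real.Gamma ((m : ℝ) + β))) := by positivity
    obtain ⟨ip, -⟩ := aux_poly _ ha c0 c1 c2 0 0
    obtain ⟨iq, -⟩ := aux_poly _ ha d0 d1 d2 d3 d4
    simp only [zero_mul, add_zero] at ip
    have hwc : ContinuousOn (fun z : ℝ => Real.exp (-z) * z ^ ((m : ℝ) + β - 1)) (Set.Ioi 0) := by
      apply ContinuousOn.mul
      · fun_prop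
      · intro z hz
        exact (Real.continuousAt_rpow_const z _ (Or.inl (ne_of_gt hz))).continuousWithinAt
    have hbound : ∀ z ∈ Set.Ioi (0:ℝ), ‖Real.exp (-z) * z ^ ((m : ℝ) + β - 1) *
        (g z - (c0 + c1 * z + c2 * z ^ 2))‖ ≤ Real.exp (-z) * z ^ ((m : ℝ) + β - 1) *
          (d0 + d1 * z + d2 * z ^ 2 + d3 * z ^ 3 + d4 * z ^ 4) := by
      intro z hz
      have : 0 ≤ Real.exp (-z) * z ^ ((m : ℝ) + β - 1) :=
        mul_nonneg (Real.exp_pos _).le (Real.rpow_nonneg (le_of_lt hz) _)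
      rw [norm_mul, Real.norm_of_nonneg this, Real.norm_eq_abs]
      exact mul_le_mul_of_nonneg_left (hle z hz) this
    have hbound' := (ae_restrict_iff' (μ := volume) measurableSet_Ioi).2
      (Filter.Eventually.of_forall hbound)
    have hcd : ContinuousOn (fun z : ℝ => Real.exp (-z) * z ^ ((m : ℝ) + β - 1) *
        (g z - (c0 + c1 * z + c2 * z ^ 2))) (Set.Ioi 0) := by
      apply hwc.mul
      apply hg.sub
      fun_prop
    have idiff : IntegrableOn (fun z : ℝ => Real.exp (-z) * z ^ ((m : ℝ) + β - 1) *
        (g z - (c0 + c1 * z + c2 * z ^ 2))) (Set.Ioi 0) :=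
      Integrable.mono' iq (hcd.aestronglyMeasurable measurableSet_Ioi) hbound'
    have ig : IntegrableOn (fun z : ℝ => Real.exp (-z) * z ^ ((m : ℝ) + β - 1) * g z)
        (Set.Ioi 0) := by
      refine (idiff.add ip).congr (Filter.Eventually.of_forall fun z => ?_)
      simp only [Pi.add_apply]; ring
    rw [← mul_sub, ← integral_sub ig ip, norm_mul, Real.norm_of_nonneg hw]
    apply mul_le_mul_of_nonneg_left _ hw
    simp only [← mul_sub]
    exact norm_integral_le_of_norm_le iq hbound'
  have hsd : Summable _ := Summable.of_norm_bounded hq.summable key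
  have hsg := hsd.add hp.summable
  simp only [sub_add_cancel] at hsg
  have hfin := tsum_of_norm_bounded hq key
  rw [hsg.tsum_sub hp.summable, hp.tsum_eq] at hfin
  have he : Real.exp (-l) * Real.exp l = 1 := by rw [← Real.exp_add]; simp
  have h3 := mul_le_mul_of_nonneg_left hfin (Real.exp_pos (-l)).le
  rw [← mul_assoc (Real.exp (-l)), he, one_mul, Real.norm_eq_abs] at h3
  rw [← abs_of_pos (Real.exp_pos (-l)), ← abs_mul] at h3
  rw [mul_sub,
    ← mul_assoc (Real.exp (-l)) (Real.exp l), he, one_mul] at h3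
  exact h3

/-- main quantitative bound -/
lemma aux_main (γ b t : ℝ) (hγ : 0 < γ) (hb : 0 < b) (ht : 0 < t) (f : ℝ → ℝ)
    (hf : ContinuousOn f (Set.Ici 0)) (x : ℝ) (hx : 0 ≤ x) (p1 p2 e C : ℝ)
    (hR : ∀ y ≥ 0, |f y - (f x + p1 * (y - x) + p2 / 2 * (y - x) ^ 2)| ≤
      e * (y - x) ^ 2 + C * (y - x) ^ 4) :
    |Psem γ b t f x - (f x + p1 * (b * t) + p2 / 2 * (2 * γ * t * x + t ^ 2 * (b ^ 2 + γ * b)))| ≤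
      e * (2 * γ * t * x + t ^ 2 * (b ^ 2 + γ * b)) +
      C * (12 * γ ^ 2 * t ^ 2 * x ^ 2 + 12 * (b + γ) * (b + 2 * γ) * γ * t ^ 3 * x
        + b * (b + γ) * (b + 2 * γ) * (b + 3 * γ) * t ^ 4) := by
  have hu : 0 < γ * t := by positivity
  have hl : 0 ≤ x / (γ * t) := by positivity
  have hβ : 0 < b / γ := by positivity
  have hg : ContinuousOn (fun z => f (γ * z * t)) (Set.Ioi 0) := by
    apply hf.comp
    · fun_prop
    · intro z hz
      have : (0:ℝ) < z := hz
      show (0:ℝ) ≤ _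
      positivity
  have H := aux_transfer (x / (γ * t)) (b / γ) hl hβ (fun z => f (γ * z * t)) hg
    (f x - p1 * x + p2 / 2 * x ^ 2) (p1 * (γ * t) - p2 * x * (γ * t)) (p2 / 2 * (γ * t) ^ 2)
    (e * x ^ 2 + C * x ^ 4) (-2 * e * x * (γ * t) - 4 * C * x ^ 3 * (γ * t))
    (e * (γ * t) ^ 2 + 6 * C * x ^ 2 * (γ * t) ^ 2) (-4 * C * x * (γ * t) ^ 3) (C * (γ * t) ^ 4)
    (by
      intro z hz
      have h := hR (γ * z * t) (by positivity)
      refine le_trans (le_of_eq ?_) (h.trans (le_of_eq ?_))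
      · congr 1; ring
      · ring)
  refine le_trans (le_of_eq ?_) (H.trans (le_of_eq ?_))
  · unfold Psem
    rw [neg_div]
    congr 2
    field_simp
    ring
  · field_simp
    ring

lemma aux_taylor (f f1 f2 : ℝ → ℝ)
    (h1 : ∀ x ≥ 0, HasDerivWithinAt f (f1 x) (Set.Ici 0) x)
    (h2 : ∀ x ≥ 0, HasDerivWithinAt f1 (f2 x) (Set.Ici 0) x)
    (x y e : ℝ) (hx : 0 ≤ x) (hy : 0 ≤ y)
    (he : ∀ w ∈ Set.uIcc x y, |f2 w - f2 x| ≤ e) :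
    |f y - (f x + f1 x * (y - x) + f2 x / 2 * (y - x) ^ 2)| ≤ e * (y - x) ^ 2 := by
  have hsub : Set.uIcc x y ⊆ Set.Ici 0 := by
    intro w hw
    exact le_trans (le_min hx hy) hw.1
  have hconv : Convex ℝ (Set.uIcc x y) := convex_uIcc x y
  have A : ∀ w ∈ Set.uIcc x y, |f1 w - f1 x - f2 x * (w - x)| ≤ e * |y - x| := by
    intro w hw
    have := hconv.norm_image_sub_le_of_norm_hasDerivWithin_le (C := e)
      (f := fun w => f1 w - f2 x * (w - x)) (f' := fun w => f2 w - f2 x)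
      (fun v hv => by
        have q1 := (h2 v (hsub hv)).mono hsub
        have q2 := (((hasDerivWithinAt_id v (Set.uIcc x y)).sub_const x).const_mul (f2 x))
        exact (q1.sub q2).congr_deriv (by simp)) he Set.left_mem_uIcc hw
    simp only [Real.norm_eq_abs, sub_self, mul_zero, sub_zero] at this
    have e0 : 0 ≤ e := (abs_nonneg _).trans (he x Set.left_mem_uIcc)
    have hwy : |w - x| ≤ |y - x| := Set.abs_sub_left_of_mem_uIcc hw
    calc |f1 w - f1 x - f2 x * (w - x)| = |f1 w - f2 x * (w - x) - f1 x| := by congr 1; ring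
      _ ≤ e * |w - x| := this
      _ ≤ e * |y - x| := by gcongr
  have := hconv.norm_image_sub_le_of_norm_hasDerivWithin_le (C := e * |y - x|)
      (f := fun w => f w - f1 x * (w - x) - f2 x / 2 * (w - x) ^ 2)
      (f' := fun w => f1 w - f1 x - f2 x * (w - x))
      (fun v hv => by
        have q1 := (h1 v (hsub hv)).mono hsub
        have q2 := (((hasDerivWithinAt_id v (Set.uIcc x y)).sub_const x).const_mul (f1 x))
        have q3 := ((((hasDerivWithinAt_id v (Set.uIcc x y)).sub_const x).pow 2).const_mul (f2 x / 2))
        have q := (q1.sub q2).sub q3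
        refine (q.congr_deriv ?_)
        simp; ring) A Set.left_mem_uIcc Set.right_mem_uIcc
  simp only [Real.norm_eq_abs, sub_self, mul_zero, sub_zero] at this
  calc _ = |f y - f1 x * (y - x) - f2 x / 2 * (y - x) ^ 2 - f x| := by congr 1; ring
    _ ≤ e * |y - x| * |y - x| := by simpa using this
    _ = _ := by rw [mul_assoc, abs_mul_abs_self]; ring

lemma aux_unif (f f1 f2 : ℝ → ℝ)
    (h1 : ∀ x ≥ 0, HasDerivWithinAt f (f1 x) (Set.Ici 0) x)
    (h2 : ∀ x ≥ 0, HasDerivWithinAt f1 (f2 x) (Set.Ici 0) x)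
    (hc : ContinuousOn f2 (Set.Ici 0)) (M0 M1 M2 K : ℝ)
    (hM0 : ∀ x ≥ 0, |f x| ≤ M0) (hM1 : ∀ x ≥ 0, |f1 x| ≤ M1) (hM2 : ∀ x ≥ 0, |f2 x| ≤ M2)
    (hK : 0 < K) (hconst : ∀ x ≥ K, f x = f K) (ε : ℝ) (hε : 0 < ε) :
    ∃ C ≥ 0, ∀ x ≥ 0, ∀ y ≥ 0, |f y - (f x + f1 x * (y - x) + f2 x / 2 * (y - x) ^ 2)| ≤
      ε / (1 + x) * (y - x) ^ 2 + C / (1 + x) ^ 2 * (y - x) ^ 4 := by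
  have n0 : 0 ≤ M0 := (abs_nonneg _).trans (hM0 0 le_rfl)
  have n1 : 0 ≤ M1 := (abs_nonneg _).trans (hM1 0 le_rfl)
  have n2 : 0 ≤ M2 := (abs_nonneg _).trans (hM2 0 le_rfl)
  have z1 : ∀ x > K, f1 x = 0 := by
    intro x hx
    have hx0 : 0 < x := hK.trans hx
    refine ((h1 x hx0.le).hasDerivAt (Ici_mem_nhds hx0)).unique
      ((hasDerivAt_const x (f K)).congr_of_eventuallyEq ?_)
    filter_upwards [Ioi_mem_nhds hx] with w hw using hconst w (le_of_lt hw)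
  have z2 : ∀ x > K, f2 x = 0 := by
    intro x hx
    have hx0 : 0 < x := hK.trans hx
    refine ((h2 x hx0.le).hasDerivAt (Ici_mem_nhds hx0)).unique
      ((hasDerivAt_const x (0:ℝ)).congr_of_eventuallyEq ?_)
    filter_upwards [Ioi_mem_nhds hx] with w hw using z1 w hw
  have huc : UniformContinuousOn f2 (Set.Icc 0 (2 * K + 1)) :=
    isCompact_Icc.uniformContinuousOn_of_continuous (hc.mono fun w hw => hw.1)
  have hε' : 0 < ε / (1 + 2 * K) := by positivity
  obtain ⟨δ', hδ', hu⟩ := Metric.uniformContinuousOn_iff.1 huc _ hε'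
  obtain ⟨δ, hδ, hδ1, hδ2⟩ : ∃ δ > 0, δ ≤ δ' ∧ δ ≤ 1 :=
    ⟨min δ' 1, by positivity, min_le_left _ _, min_le_right _ _⟩
  set c0 : ℝ := K ^ 2 / (2 * K + 1) with hc0
  have hc0p : 0 < c0 := by positivity
  set C1 : ℝ := (1 + 2 * K) ^ 2 * (2 * M0 / δ ^ 4 + M1 / δ ^ 3 + M2 / δ ^ 2) with hC1
  have hC1p : 0 ≤ C1 := by positivity
  set C2 : ℝ := 2 * M0 / c0 ^ 2 with hC2
  have hC2p : 0 ≤ C2 := by positivity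
  refine ⟨C1 + C2, by positivity, ?_⟩
  intro x hx y hy
  have hx1 : 0 < 1 + x := by linarith [hx]
  rcases le_or_gt x (2 * K) with hxK | hxK
  · rcases lt_or_ge |y - x| δ with hd | hd
    · have T := aux_taylor f f1 f2 h1 h2 x y (ε / (1 + 2 * K)) hx hy (by
        intro w hw
        have hw0 : 0 ≤ w := le_trans (le_min hx hy) hw.1
        have hwx : |w - x| ≤ |y - x| := Set.abs_sub_left_of_mem_uIcc hw
        have hw1 : w ≤ 2 * K + 1 := by
          have := le_abs_self (w - x)
          linarith
        have := hu w ⟨hw0, hw1⟩ x ⟨hx, by linarith⟩ (by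
          rw [Real.dist_eq]; linarith)
        rw [Real.dist_eq] at this
        exact this.le)
      have a1 : ε / (1 + 2 * K) * (y - x) ^ 2 ≤ ε / (1 + x) * (y - x) ^ 2 := by gcongr
      have a2 : 0 ≤ (C1 + C2) / (1 + x) ^ 2 * (y - x) ^ 4 := by positivity
      linarith
    · set d := |y - x| with hdd
      have hd0 : 0 < d := lt_of_lt_of_le hδ hd
      have e2 : (y - x) ^ 2 = d ^ 2 := (sq_abs _).symm
      have e4 : (y - x) ^ 4 = d ^ 4 := by
        have : (y - x) ^ 4 = ((y - x) ^ 2) ^ 2 := by ring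
        rw [this, e2]; ring
      have b0 : |f y - (f x + f1 x * (y - x) + f2 x / 2 * (y - x) ^ 2)| ≤
          2 * M0 + M1 * d + M2 * d ^ 2 := by
        have t1 : |f1 x * (y - x)| ≤ M1 * d := by
          rw [abs_mul]; gcongr; exact hM1 x hx
        have t2 : |f2 x / 2 * (y - x) ^ 2| ≤ M2 * d ^ 2 := by
          rw [abs_mul, e2, abs_of_nonneg (sq_nonneg d)]
          gcongr
          rw [abs_div, abs_two]
          have := hM2 x hx
          have := abs_nonneg (f2 x)
          linarith
        have t3 := hM0 x hx
        have t4 := hM0 y hy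
        rw [abs_le] at *
        constructor <;> linarith [t1.1, t1.2, t2.1, t2.2, t3.1, t3.2, t4.1, t4.2]
      have r : 1 ≤ d / δ := (one_le_div hδ).2 hd
      have s0 : 2 * M0 ≤ 2 * M0 / δ ^ 4 * d ^ 4 := by
        have : 1 ≤ (d / δ) ^ 4 := one_le_pow₀ r
        calc 2 * M0 = 2 * M0 * 1 := by ring
          _ ≤ 2 * M0 * (d / δ) ^ 4 := by gcongr
          _ = _ := by rw [div_pow]; ring
      have s1 : M1 * d ≤ M1 / δ ^ 3 * d ^ 4 := by
        have : 1 ≤ (d / δ) ^ 3 := one_le_pow₀ r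
        calc M1 * d = M1 * d * 1 := by ring
          _ ≤ M1 * d * (d / δ) ^ 3 := by gcongr
          _ = _ := by rw [div_pow]; ring
      have s2 : M2 * d ^ 2 ≤ M2 / δ ^ 2 * d ^ 4 := by
        have : 1 ≤ (d / δ) ^ 2 := one_le_pow₀ r
        calc M2 * d ^ 2 = M2 * d ^ 2 * 1 := by ring
          _ ≤ M2 * d ^ 2 * (d / δ) ^ 2 := by gcongr
          _ = _ := by rw [div_pow]; ring
      have s3 : (2 * M0 / δ ^ 4 + M1 / δ ^ 3 + M2 / δ ^ 2) ≤ (C1 + C2) / (1 + x) ^ 2 := by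
        rw [le_div_iff₀ (by positivity), mul_comm]
        calc _ ≤ C1 := by rw [hC1]; gcongr
          _ ≤ _ := by linarith
      have s4 := mul_le_mul_of_nonneg_right s3 (by positivity : 0 ≤ d ^ 4)
      have s5 : 0 ≤ ε / (1 + x) * (y - x) ^ 2 := by positivity
      rw [e4]
      linarith
  · have hxK' : K < x := by linarith
    rw [z1 x hxK', z2 x hxK']
    have s5 : 0 ≤ ε / (1 + x) * (y - x) ^ 2 := by positivity
    rcases le_or_gt K y with hyK | hyK
    · rw [hconst y hyK, hconst x hxK'.le]
      have a2 : 0 ≤ (C1 + C2) / (1 + x) ^ 2 * (y - x) ^ 4 := by positivity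
      simp only [zero_mul, add_zero, zero_div, sub_self, abs_zero]
      linarith
    · have t3 := hM0 x hx
      have t4 := hM0 y hy
      have b0 : |f y - (f x + 0 * (y - x) + 0 / 2 * (y - x) ^ 2)| ≤ 2 * M0 := by
        have : f y - (f x + 0 * (y - x) + 0 / 2 * (y - x) ^ 2) = f y - f x := by ring
        rw [this]
        rw [abs_le] at *
        constructor <;> linarith [t3.1, t3.2, t4.1, t4.2]
      have q1 : x / 2 ≤ x - y := by linarith
      have q2 : (x / 2) ^ 2 ≤ (x - y) ^ 2 := by gcongr
      have q3 : c0 ≤ (y - x) ^ 2 / (1 + x) := by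
        rw [le_div_iff₀ hx1, hc0, div_mul_eq_mul_div, div_le_iff₀ (by positivity)]
        have q4 : (y - x) ^ 2 = (x - y) ^ 2 := by ring
        rw [q4]
        have q5 : K ^ 2 * (1 + x) ≤ (x / 2) ^ 2 * (2 * K + 1) := by
          have u1 : K ^ 2 ≤ (x / 2) ^ 2 := by
            have : K ≤ x / 2 := by linarith
            gcongr
          have u2 : K ^ 2 * x ≤ (x / 2) ^ 2 * (2 * K) := by
            have : 0 ≤ K * x * (x - 2 * K) := by
              have := sub_nonneg.2 hxK.le
              positivity
            nlinarith
          linarith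
        exact q5.trans (by gcongr)
      have q6 : c0 ^ 2 ≤ ((y - x) ^ 2 / (1 + x)) ^ 2 := by gcongr
      have q7 : 2 * M0 ≤ C2 * ((y - x) ^ 2 / (1 + x)) ^ 2 := by
        calc 2 * M0 = C2 * c0 ^ 2 := by rw [hC2]; field_simp
          _ ≤ _ := by gcongr
      have q8 : (C1 + C2) / (1 + x) ^ 2 * (y - x) ^ 4 =
          (C1 + C2) * ((y - x) ^ 2 / (1 + x)) ^ 2 := by
        rw [div_pow]; ring
      have q9 : 0 ≤ C1 * ((y - x) ^ 2 / (1 + x)) ^ 2 := by positivity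
      rw [q8]
      linarith

/-- final pointwise estimate -/
lemma aux_est (γ b t x M2 ε C P F p1 p2 : ℝ) (hγ : 0 < γ) (hb : 0 < b) (ht : 0 < t) (ht1 : t ≤ 1)
    (hx : 0 ≤ x) (hε : 0 < ε) (hC : 0 ≤ C) (hp2 : |p2| ≤ M2)
    (h : |P - (F + p1 * (b * t) + p2 / 2 * (2 * γ * t * x + t ^ 2 * (b ^ 2 + γ * b)))| ≤
      ε / (1 + x) * (2 * γ * t * x + t ^ 2 * (b ^ 2 + γ * b)) +
      C / (1 + x) ^ 2 * (12 * γ ^ 2 * t ^ 2 * x ^ 2 + 12 * (b + γ) * (b + 2 * γ) * γ * t ^ 3 * x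
        + b * (b + γ) * (b + 2 * γ) * (b + 3 * γ) * t ^ 4)) :
    |(P - F) / t - (γ * x * p2 + b * p1)| ≤
      ε * (2 * γ + (b ^ 2 + γ * b)) + t * (M2 * (b ^ 2 + γ * b) +
        C * (12 * γ ^ 2 + 12 * (b + γ) * (b + 2 * γ) * γ
          + b * (b + γ) * (b + 2 * γ) * (b + 3 * γ))) := by
  have hx1 : 0 < 1 + x := by linarith
  set B := b ^ 2 + γ * b with hB
  set D1 := 12 * (b + γ) * (b + 2 * γ) * γ with hD1
  set D2 := b * (b + γ) * (b + 2 * γ) * (b + 3 * γ) with hD2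
  have hBp : 0 ≤ B := by positivity
  have hD1p : 0 ≤ D1 := by positivity
  have hD2p : 0 ≤ D2 := by positivity
  have e1 : (P - F) / t - (γ * x * p2 + b * p1) =
      (P - (F + p1 * (b * t) + p2 / 2 * (2 * γ * t * x + t ^ 2 * B))) / t + p2 / 2 * (t * B) := by
    field_simp; ring
  rw [e1]
  refine (abs_add_le _ _).trans ?_
  have e2 : |p2 / 2 * (t * B)| ≤ t * (M2 * B) := by
    rw [abs_mul, abs_of_nonneg (by positivity : 0 ≤ t * B), abs_div, abs_two]
    have : |p2| / 2 ≤ M2 := by linarith [abs_nonneg p2]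
    calc _ ≤ M2 * (t * B) := by gcongr
      _ = _ := by ring
  have r1 : x / (1 + x) ≤ 1 := (div_le_one hx1).2 (by linarith)
  have r0 : 0 ≤ x / (1 + x) := by positivity
  have r2 : 1 / (1 + x) ≤ 1 := (div_le_one hx1).2 (by linarith)
  have r3 : 0 ≤ 1 / (1 + x) := by positivity
  have e3 : |(P - (F + p1 * (b * t) + p2 / 2 * (2 * γ * t * x + t ^ 2 * B))) / t| ≤
      ε * (2 * γ + B) + t * (C * (12 * γ ^ 2 + D1 + D2)) := by
    rw [abs_div, abs_of_pos ht, div_le_iff₀ ht]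
    refine h.trans ?_
    have e4 : ε / (1 + x) * (2 * γ * t * x + t ^ 2 * B) ≤ ε * (2 * γ + B) * t := by
      calc _ = ε * (2 * γ * (x / (1 + x)) + t * B * (1 / (1 + x))) * t := by ring
        _ ≤ ε * (2 * γ * 1 + 1 * B * 1) * t := by gcongr
        _ = _ := by ring
    have e5 : C / (1 + x) ^ 2 * (12 * γ ^ 2 * t ^ 2 * x ^ 2 + D1 * t ^ 3 * x + D2 * t ^ 4) ≤
        t * (C * (12 * γ ^ 2 + D1 + D2)) * t := by
      calc _ = t * (C * (12 * γ ^ 2 * (x / (1 + x)) ^ 2 + D1 * t * ((x / (1 + x)) * (1 / (1 + x)))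
              + D2 * t ^ 2 * (1 / (1 + x)) ^ 2)) * t := by field_simp
        _ ≤ t * (C * (12 * γ ^ 2 * 1 ^ 2 + D1 * 1 * (1 * 1) + D2 * 1 ^ 2 * 1 ^ 2)) * t := by gcongr
        _ = _ := by ring
    linarith
  linarith

/-- Let `γ > 0`, `b > 0` and let `f : [0,∞) → ℝ` be twice continuously differentiable
with `f, f', f''` bounded and `f` constant on some `[K,∞)`. Then
`lim_{t → 0⁺} sup_{x ≥ 0} |(P_t^{γ,b} f(x) − f(x))/t − (γ x f''(x) + b f'(x))| = 0`. -/
theorem stmt13 (γ b : ℝ) (hγ : 0 < γ) (hb : 0 < b) (f : ℝ → ℝ)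
    (hf : ContDiffOn ℝ 2 f (Set.Ici 0))
    (hbd0 : ∃ K, ∀ x ≥ (0:ℝ), |f x| ≤ K)
    (hbd1 : ∃ K, ∀ x ≥ (0:ℝ), |derivWithin f (Set.Ici 0) x| ≤ K)
    (hbd2 : ∃ K, ∀ x ≥ (0:ℝ),
      |derivWithin (derivWithin f (Set.Ici 0)) (Set.Ici 0) x| ≤ K)
    (hconst : ∃ K > (0:ℝ), ∀ x ≥ K, f x = f K) :
    Filter.Tendsto
      (fun t => ⨆ x : Set.Ici (0:ℝ),
        |(Psem γ b t f (x : ℝ) - f (x : ℝ)) / t -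
          (γ * (x : ℝ) * derivWithin (derivWithin f (Set.Ici 0)) (Set.Ici 0) (x : ℝ) +
            b * derivWithin f (Set.Ici 0) (x : ℝ))|)
      (nhdsWithin 0 (Set.Ioi 0)) (nhds 0) := by
  obtain ⟨M0, hM0⟩ := hbd0
  obtain ⟨M1, hM1⟩ := hbd1
  obtain ⟨M2, hM2⟩ := hbd2
  obtain ⟨K, hK, hconst⟩ := hconst
  have hud : UniqueDiffOn ℝ (Set.Ici (0:ℝ)) := uniqueDiffOn_Ici 0
  have hf1 : ContDiffOn ℝ 1 (derivWithin f (Set.Ici 0)) (Set.Ici 0) :=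
    hf.derivWithin hud (by norm_num)
  have h1 : ∀ x ≥ (0:ℝ), HasDerivWithinAt f (derivWithin f (Set.Ici 0) x) (Set.Ici 0) x :=
    fun x hx => ((hf.differentiableOn (by norm_num)) x hx).hasDerivWithinAt
  have h2 : ∀ x ≥ (0:ℝ), HasDerivWithinAt (derivWithin f (Set.Ici 0))
      (derivWithin (derivWithin f (Set.Ici 0)) (Set.Ici 0) x) (Set.Ici 0) x :=
    fun x hx => ((hf1.differentiableOn (by norm_num)) x hx).hasDerivWithinAt
  have hc : ContinuousOn (derivWithin (derivWithin f (Set.Ici 0)) (Set.Ici 0)) (Set.Ici 0) :=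
    hf1.continuousOn_derivWithin hud le_rfl
  set f1 := derivWithin f (Set.Ici 0) with hf1d
  set f2 := derivWithin f1 (Set.Ici 0) with hf2d
  have n2 : 0 ≤ M2 := (abs_nonneg _).trans (hM2 0 le_rfl)
  rw [Metric.tendsto_nhds]
  intro η hη
  set A := 2 * γ + (b ^ 2 + γ * b) with hA
  have hAp : 0 < A := by positivity
  obtain ⟨C, hC, hR⟩ := aux_unif f f1 f2 h1 h2 hc M0 M1 M2 K hM0 hM1 hM2 hK hconst
    (η / (4 * A)) (by positivity)
  set D := M2 * (b ^ 2 + γ * b) + C * (12 * γ ^ 2 + 12 * (b + γ) * (b + 2 * γ) * γ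
          + b * (b + γ) * (b + 2 * γ) * (b + 3 * γ)) with hD
  have hDp : 0 ≤ D := by positivity
  have hev : Set.Ioo (0:ℝ) (min 1 (η / (4 * (D + 1)))) ∈ nhdsWithin (0:ℝ) (Set.Ioi 0) :=
    Ioo_mem_nhdsGT (by positivity)
  filter_upwards [hev] with t ht
  have ht0 : 0 < t := ht.1
  have ht1 : t ≤ 1 := ht.2.le.trans (min_le_left _ _)
  have ht2 : t ≤ η / (4 * (D + 1)) := ht.2.le.trans (min_le_right _ _)
  have htD : t * D ≤ η / 4 := by
    rw [le_div_iff₀ (by positivity)] at ht2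
    nlinarith
  rw [Real.dist_eq, sub_zero, abs_of_nonneg (Real.iSup_nonneg fun _ => abs_nonneg _)]
  refine lt_of_le_of_lt (Real.iSup_le (a := η / 2) ?_ (by positivity)) (by linarith)
  rintro ⟨x, hx⟩
  have E := aux_est γ b t x M2 (η / (4 * A)) C (Psem γ b t f x) (f x) (f1 x) (f2 x) hγ hb ht0 ht1
    hx (by positivity) hC (hM2 x hx)
    (aux_main γ b t hγ hb ht0 f hf.continuousOn x hx (f1 x) (f2 x) _ _ (hR x hx))
  refine E.trans ?_
  have : η / (4 * A) * A = η / 4 := by field_simp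
  rw [this]
  linarith
end

section
/- Let γ > 0 and b ≥ 0, and let u ∈ D(A^{γ,b}). Then there exists a sequence (u_n) of functions u_n : [0,∞) → ℝ, each twice continuously differentiable on [0,∞) and constant on some interval [K_n, ∞), such that u_n → u uniformly on [0,∞) and γ x u_n''(x) + b u_n'(x) → γ x u''(x) + b u'(x) uniformly in x on [0,∞) as n → ∞. -/
open MeasureTheory

/-- The first derivative of `u` on `[0,∞)` (one-sided at `0`). -/
noncomputable def d1 (u : ℝ → ℝ) : ℝ → ℝ := derivWithin u (Set.Ici 0)

/-- The second derivative of `u` on `[0,∞)` (one-sided at `0`). -/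
noncomputable def d2 (u : ℝ → ℝ) : ℝ → ℝ := derivWithin (derivWithin u (Set.Ici 0)) (Set.Ici 0)

/-- `u ∈ D(A^{γ,b})`. For `b > 0`: `u` is `C¹` on `[0,∞)`, `C²` on `(0,∞)`, has a finite limit
at `+∞`, `x u''(x) → 0` as `x → 0⁺`, and `γ x u''(x) + b u'(x) → 0` as `x → +∞`.
For `b = 0`: `u` is continuous on `[0,∞)`, `C²` on `(0,∞)`, has a finite limit at `+∞`,
`γ x u''(x) → 0` as `x → 0⁺` and as `x → +∞`. -/
def memDomain (γ b : ℝ) (u : ℝ → ℝ) : Prop :=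
  (0 < b ∧ ContDiffOn ℝ 1 u (Set.Ici 0) ∧ ContDiffOn ℝ 2 u (Set.Ioi 0) ∧
    (∃ l, Filter.Tendsto u Filter.atTop (nhds l)) ∧
    Filter.Tendsto (fun x => x * d2 u x) (nhdsWithin 0 (Set.Ioi 0)) (nhds 0) ∧
    Filter.Tendsto (fun x => γ * x * d2 u x + b * d1 u x) Filter.atTop (nhds 0)) ∨
  (b = 0 ∧ ContinuousOn u (Set.Ici 0) ∧ ContDiffOn ℝ 2 u (Set.Ioi 0) ∧
    (∃ l, Filter.Tendsto u Filter.atTop (nhds l)) ∧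
    Filter.Tendsto (fun x => γ * x * d2 u x) (nhdsWithin 0 (Set.Ioi 0)) (nhds 0) ∧
    Filter.Tendsto (fun x => γ * x * d2 u x) Filter.atTop (nhds 0))

open Set Filter Topology

theorem smooth_facts {f f1 f2 : ℝ → ℝ} (h1 : ∀ x, HasDerivAt f (f1 x) x)
    (h2 : ∀ x, HasDerivAt f1 (f2 x) x) (hc : Continuous f2) :
    ContDiff ℝ 2 f ∧ (∀ x, 0 ≤ x → d1 f x = f1 x) ∧ (∀ x, 0 ≤ x → d2 f x = f2 x) := by
  have e1 : deriv f = f1 := funext fun x => (h1 x).deriv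
  have e2 : deriv f1 = f2 := funext fun x => (h2 x).deriv
  have hd1 : ∀ x, 0 ≤ x → d1 f x = f1 x := fun x hx =>
    (h1 x).hasDerivWithinAt.derivWithin (uniqueDiffOn_Ici 0 x hx)
  refine ⟨?_, hd1, ?_⟩
  · have : ContDiff ℝ 1 f1 := by
      rw [contDiff_one_iff_deriv]
      exact ⟨fun x => (h2 x).differentiableAt, by rw [e2]; exact hc⟩
    have h3 : ContDiff ℝ (1 + 1) f := by
      rw [contDiff_succ_iff_deriv]
      refine ⟨fun x => (h1 x).differentiableAt, by simp, by rw [e1]; exact this⟩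
    simpa [one_add_one_eq_two] using h3
  · intro x hx
    have : d2 f x = derivWithin f1 (Ici 0) x :=
      derivWithin_congr (fun y hy => hd1 y hy) (hd1 x hx)
    rw [this]
    exact (h2 x).hasDerivWithinAt.derivWithin (uniqueDiffOn_Ici 0 x hx)

theorem pos_facts {u : ℝ → ℝ} (hu : ContDiffOn ℝ 2 u (Ioi 0)) :
    (∀ x, 0 < x → HasDerivAt u (d1 u x) x) ∧ (∀ x, 0 < x → HasDerivAt (d1 u) (d2 u x) x) ∧
    ContinuousOn (d2 u) (Ioi 0) := by
  have e1 : ∀ x, 0 < x → d1 u x = deriv u x := fun x hx =>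
    derivWithin_of_mem_nhds (Ici_mem_nhds hx)
  have hu' : ContDiffOn ℝ (1 + 1) u (Ioi 0) := by simpa [one_add_one_eq_two] using hu
  rw [contDiffOn_succ_iff_deriv_of_isOpen isOpen_Ioi] at hu'
  obtain ⟨hd, -, hc1⟩ := hu'
  have hd1 : ContDiffOn ℝ (0 + 1) (d1 u) (Ioi 0) := by
    simpa using hc1.congr (fun x hx => e1 x hx)
  rw [contDiffOn_succ_iff_deriv_of_isOpen isOpen_Ioi] at hd1
  obtain ⟨hdd, -, hc2⟩ := hd1
  have e2 : ∀ x, 0 < x → d2 u x = deriv (d1 u) x := fun x hx =>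
    derivWithin_of_mem_nhds (Ici_mem_nhds hx)
  refine ⟨fun x hx => ?_, fun x hx => ?_, ?_⟩
  · rw [e1 x hx]; exact ((hd x hx).differentiableAt (Ioi_mem_nhds hx)).hasDerivAt
  · rw [e2 x hx]; exact ((hdd x hx).differentiableAt (Ioi_mem_nhds hx)).hasDerivAt
  · exact hc2.continuousOn.congr (fun x hx => e2 x hx)

theorem glue {f g f' g' : ℝ → ℝ} {a : ℝ} (hf : ∀ x ≤ a, HasDerivAt f (f' x) x)
    (hg : ∀ x, a ≤ x → HasDerivAt g (g' x) x) (h0 : f a = g a) (h1 : f' a = g' a) (x : ℝ) :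
    HasDerivAt (fun x => if x ≤ a then f x else g x) (if x ≤ a then f' x else g' x) x := by
  rcases lt_trichotomy x a with h | h | h
  · rw [if_pos h.le]
    refine (hf x h.le).congr_of_eventuallyEq ?_
    filter_upwards [Iio_mem_nhds h] with y hy
    rw [if_pos (le_of_lt hy)]
  · subst h
    rw [if_pos le_rfl]
    rw [← hasDerivWithinAt_univ, ← Iic_union_Ici (a := x)]
    refine HasDerivWithinAt.union ?_ ?_
    · refine (hf x le_rfl).hasDerivWithinAt.congr (fun y hy => if_pos hy) (if_pos le_rfl)
    · rw [h1]
      refine (hg x le_rfl).hasDerivWithinAt.congr (fun y hy => ?_) (by simp [h0])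
      split_ifs with h
      · rw [le_antisymm h hy, h0]
      · rfl
  · rw [if_neg h.not_ge]
    refine (hg x h.le).congr_of_eventuallyEq ?_
    filter_upwards [Ioi_mem_nhds h] with y hy
    rw [if_neg (not_le.2 hy)]

/-- Decay of x times the derivative at zero. -/
theorem xd1_zero {u u1 u2 : ℝ → ℝ} (hc : ContinuousWithinAt u (Ici 0) 0)
    (h1 : ∀ x, 0 < x → HasDerivAt u (u1 x) x) (h2 : ∀ x, 0 < x → HasDerivAt u1 (u2 x) x)
    (h : Tendsto (fun x => x * u2 x) (𝓝[>] 0) (𝓝 0)) :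
    Tendsto (fun x => x * u1 x) (𝓝[>] 0) (𝓝 0) := by
  rw [Metric.tendsto_nhdsWithin_nhds] at h ⊢
  rw [Metric.continuousWithinAt_iff] at hc
  intro ε hε
  obtain ⟨r, hr, hr'⟩ := h (ε / 4) (by positivity)
  obtain ⟨s, hs, hs'⟩ := hc (ε / 4) (by positivity)
  simp only [Real.dist_eq, sub_zero, mem_Ioi, mem_Ici] at hr' hs' ⊢
  refine ⟨min 1 (min (r / 2) (s / 2)), by positivity, fun x hx hxd => ?_⟩
  rw [abs_of_pos hx] at hxd
  obtain ⟨hx1, hx2⟩ := lt_min_iff.1 hxd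
  obtain ⟨hx2, hx3⟩ := lt_min_iff.1 hx2
  obtain ⟨ξ, hξ, hξe⟩ := exists_hasDerivAt_eq_slope u u1 (show x < 2 * x by linarith)
    (fun y hy => (h1 y (by linarith [hy.1])).continuousAt.continuousWithinAt)
    (fun y hy => h1 y (by linarith [hy.1]))
  obtain ⟨η, hη, hηe⟩ := exists_hasDerivAt_eq_slope u1 u2 hξ.1
    (fun y hy => (h2 y (by linarith [hy.1])).continuousAt.continuousWithinAt)
    (fun y hy => h2 y (by linarith [hy.1]))
  have hη0 : 0 < η := hx.trans hη.1
  have ηr := hr' hη0 (by rw [abs_of_pos hη0]; linarith [hη.2, hξ.2])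
  have A := hs' hx.le (by rw [abs_of_pos hx]; linarith)
  have B := hs' (show 0 ≤ 2 * x by linarith) (by rw [abs_of_pos (by linarith)]; linarith)
  have e1 : x * u1 ξ = u (2 * x) - u x := by rw [hξe]; field_simp; ring
  have hξx : 0 < ξ - x := by linarith [hξ.1]
  have e2 : u1 ξ - u1 x = u2 η * (ξ - x) := by rw [hηe]; field_simp
  have e3 : x * u1 x = (u (2 * x) - u 0) - (u x - u 0) - x * (ξ - x) * u2 η := by
    linear_combination e1 - x * e2
  have e4 : |x * (ξ - x) * u2 η| ≤ |η * u2 η| := by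
    rw [abs_mul, abs_mul η]
    refine mul_le_mul_of_nonneg_right ?_ (abs_nonneg _)
    rw [abs_of_pos (by positivity), abs_of_pos hη0]
    nlinarith [hξ.2, hη.1]
  rw [e3]
  rw [abs_lt] at *
  rw [abs_le] at e4
  have := abs_lt.2 ηr
  constructor <;> linarith

/-- The derivative tends to zero at infinity. -/
theorem d1_atTop {γ b l : ℝ} (hγ : 0 < γ) (hb : 0 ≤ b) {u u1 u2 : ℝ → ℝ}
    (hl : Tendsto u atTop (𝓝 l))
    (h1 : ∀ x, 0 < x → HasDerivAt u (u1 x) x) (h2 : ∀ x, 0 < x → HasDerivAt u1 (u2 x) x)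
    (h : Tendsto (fun x => γ * x * u2 x + b * u1 x) atTop (𝓝 0)) :
    Tendsto u1 atTop (𝓝 0) := by
  rw [Metric.tendsto_atTop] at h hl ⊢
  intro ε hε
  obtain ⟨r, hr⟩ := h (γ * ε / 8) (by positivity)
  obtain ⟨s, hs⟩ := hl (ε / 8) (by positivity)
  simp only [Real.dist_eq, sub_zero] at hr hs ⊢
  refine ⟨max 1 (max (2 * b / γ) (max r s)), fun x hx => ?_⟩
  simp only [ge_iff_le, max_le_iff] at hx
  obtain ⟨hx1, hx2, hx3, hx4⟩ := hx
  obtain ⟨y, hy, hmax⟩ := isCompact_Icc.exists_isMaxOn (nonempty_Icc.2 (show x ≤ x + 1 by linarith))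
    (f := fun y => |u1 y|)
    (fun y hy => (h2 y (by linarith [hy.1])).continuousAt.abs.continuousWithinAt)
  have hmax' : ∀ z ∈ Icc x (x + 1), |u1 z| ≤ |u1 y| := fun z hz => hmax hz
  obtain ⟨ξ, hξ, hξe⟩ := exists_hasDerivAt_eq_slope u u1 (show x < x + 1 by linarith)
    (fun y hy => (h1 y (by linarith [hy.1])).continuousAt.continuousWithinAt)
    (fun y hy => h1 y (by linarith [hy.1]))
  have hξs : |u1 ξ| < ε / 4 := by
    have A := hs x hx4
    have B := hs (x + 1) (by linarith)
    rw [hξe]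
    simp only [add_sub_cancel_left, div_one]
    rw [abs_lt] at *
    constructor <;> linarith
  have hbx : 2 * b ≤ γ * x := by rw [div_le_iff₀ hγ] at hx2; linarith
  have key : ∀ z ∈ Icc x (x + 1), |u2 z| ≤ ε / 8 + |u1 y| / 2 := by
    intro z hz
    have A := hr z (hx3.trans hz.1)
    have B := hmax' z hz
    have hz0 : 0 < γ * z := mul_pos hγ (by linarith [hz.1])
    have hzx : γ * x ≤ γ * z := mul_le_mul_of_nonneg_left hz.1 hγ.le
    have hg : γ ≤ γ * z := by nlinarith [hz.1]
    have C : |γ * z * u2 z| ≤ γ * ε / 8 + b * |u1 y| := by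
      have : γ * z * u2 z = (γ * z * u2 z + b * u1 z) - b * u1 z := by ring
      rw [this]
      refine (abs_sub _ _).trans ?_
      rw [abs_mul b, abs_of_nonneg hb]
      have := mul_le_mul_of_nonneg_left B hb
      linarith
    rw [abs_mul, abs_of_pos hz0] at C
    have : γ * z * |u2 z| ≤ γ * z * (ε / 8 + |u1 y| / 2) := by
      have := abs_nonneg (u1 y)
      nlinarith
    exact le_of_mul_le_mul_left this hz0
  have hdiff : |u1 y - u1 ξ| ≤ (ε / 8 + |u1 y| / 2) * |y - ξ| := by
    have := (convex_Icc x (x + 1)).norm_image_sub_le_of_norm_hasDerivWithin_le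
      (f := u1) (f' := u2) (C := ε / 8 + |u1 y| / 2)
      (fun z hz => (h2 z (by linarith [hz.1])).hasDerivWithinAt)
      (fun z hz => key z hz) (Ioo_subset_Icc_self hξ) hy
    simpa using this
  have hyξ : |y - ξ| ≤ 1 := by
    rw [abs_le]; constructor <;> linarith [hy.1, hy.2, hξ.1, hξ.2]
  have : |u1 y| - |u1 ξ| ≤ |u1 y - u1 ξ| := abs_sub_abs_le_abs_sub _ _
  have hn := abs_nonneg (u1 y)
  have : |u1 y| ≤ |u1 ξ| + (ε / 8 + |u1 y| / 2) := by nlinarith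
  have := hmax' x ⟨le_rfl, by linarith⟩
  linarith

/-- Modification near zero. -/
theorem near_zero {γ b : ℝ} (hγ : 0 < γ) (hb : 0 ≤ b) {u u1 u2 : ℝ → ℝ}
    (hc : ContinuousWithinAt u (Ici 0) 0)
    (h1 : ∀ x, 0 < x → HasDerivAt u (u1 x) x) (h2 : ∀ x, 0 < x → HasDerivAt u1 (u2 x) x)
    (h2c : ContinuousOn u2 (Ioi 0))
    (h : Tendsto (fun x => x * u2 x) (𝓝[>] 0) (𝓝 0))
    (hbc : ContinuousWithinAt (fun x => b * u1 x) (Ici 0) 0) (ε : ℝ) (hε : 0 < ε) :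
    ∃ w w1 w2 : ℝ → ℝ, (∀ x, HasDerivAt w (w1 x) x) ∧ (∀ x, HasDerivAt w1 (w2 x) x) ∧
      Continuous w2 ∧ (∀ x, 0 ≤ x → |w x - u x| ≤ ε) ∧
      (∀ x, 0 ≤ x → |(γ * x * w2 x + b * w1 x) - (γ * x * u2 x + b * u1 x)| ≤ ε) ∧
      (∀ x, 1 < x → w x = u x ∧ w1 x = u1 x ∧ w2 x = u2 x) := by
  have h' := xd1_zero hc h1 h2 h
  obtain ⟨δ, hδ, hδ1, hδ2⟩ : ∃ δ > 0, 4 * δ ≤ ε ∧ (2 * γ + 2 + b) * δ ≤ ε := by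
    have hp : 0 < 2 * γ + 2 + b := by positivity
    refine ⟨min (ε / 4) (ε / (2 * γ + 2 + b)), by positivity, ?_, ?_⟩
    · linarith [min_le_left (ε / 4) (ε / (2 * γ + 2 + b))]
    · have := min_le_right (ε / 4) (ε / (2 * γ + 2 + b))
      rw [le_div_iff₀ hp] at this
      linarith
  rw [Metric.tendsto_nhdsWithin_nhds] at h h'
  rw [Metric.continuousWithinAt_iff] at hc hbc
  obtain ⟨r1, hr1, h⟩ := h δ hδ
  obtain ⟨r2, hr2, h'⟩ := h' δ hδ
  obtain ⟨r3, hr3, hc⟩ := hc δ hδ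
  obtain ⟨r4, hr4, hbc⟩ := hbc δ hδ
  simp only [Real.dist_eq, sub_zero, mem_Ioi, mem_Ici] at h h' hc hbc
  obtain ⟨a, ha0, ha⟩ : ∃ a > 0, a < min 1 (min r1 (min r2 (min r3 r4))) :=
    exists_between (by positivity)
  simp only [lt_min_iff] at ha
  obtain ⟨ha1, har1, har2, har3, har4⟩ := ha
  set p : ℝ → ℝ := fun x => u a + u1 a * (x - a) + u2 a * (x - a) ^ 2 / 2 with hp
  set p1 : ℝ → ℝ := fun x => u1 a + u2 a * (x - a) with hp1
  have dp : ∀ x, HasDerivAt p (p1 x) x := by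
    intro x
    have e := (hasDerivAt_id x).sub_const a
    have := ((e.const_mul (u1 a)).const_add (u a)).add (((e.pow 2).const_mul (u2 a)).div_const 2)
    refine this.congr_deriv ?_
    simp [hp1]
    ring
  have dp1 : ∀ x, HasDerivAt p1 (u2 a) x := by
    intro x
    have e := (hasDerivAt_id x).sub_const a
    exact ((e.const_mul (u2 a)).const_add (u1 a)).congr_deriv (by simp)
  have A1 := h ha0 (by rwa [abs_of_pos ha0])
  have A2 := h' ha0 (by rwa [abs_of_pos ha0])
  have A3 := hc ha0.le (by rwa [abs_of_pos ha0])
  have A4 := hbc ha0.le (by rwa [abs_of_pos ha0])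
  refine ⟨fun x => if x ≤ a then p x else u x, fun x => if x ≤ a then p1 x else u1 x,
    fun x => if x ≤ a then u2 a else u2 x, ?_, ?_, ?_, ?_, ?_, ?_⟩
  · exact glue (fun x _ => dp x) (fun x hx => h1 x (by linarith)) (by simp [hp]) (by simp [hp1])
  · exact glue (f' := fun _ => u2 a) (fun x _ => dp1 x) (fun x hx => h2 x (by linarith))
      (by simp [hp1]) rfl
  · have : (fun x => if x ≤ a then u2 a else u2 x) = fun x => u2 (max x a) := by
      funext x
      split_ifs with hx
      · rw [max_eq_right hx]
      · rw [max_eq_left (not_le.1 hx).le]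
    rw [this]
    exact h2c.comp_continuous (by fun_prop) (fun x => lt_of_lt_of_le ha0 (le_max_right _ _))
  · intro x hx
    show |(if x ≤ a then p x else u x) - u x| ≤ ε
    split_ifs with hxa
    · have B3 := hc hx (by rw [abs_of_nonneg hx]; linarith)
      have C1 : |u1 a * (x - a)| ≤ |a * u1 a| := by
        rw [abs_mul, abs_mul, mul_comm]
        refine mul_le_mul_of_nonneg_right ?_ (abs_nonneg _)
        rw [abs_of_pos ha0, abs_le]; constructor <;> linarith
      have C2 : |u2 a * (x - a) ^ 2 / 2| ≤ |a * u2 a| := by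
        rw [mul_div_assoc, abs_mul, abs_mul, mul_comm]
        refine mul_le_mul_of_nonneg_right ?_ (abs_nonneg _)
        rw [abs_of_pos ha0, abs_of_nonneg (by positivity)]
        nlinarith
      have e : p x - u x = (u a - u 0) - (u x - u 0) + u1 a * (x - a) + u2 a * (x - a) ^ 2 / 2 := by
        simp only [hp]; ring
      rw [e]
      rw [abs_lt] at A3 B3
      have C1 := abs_le.1 (C1.trans A2.le)
      have C2 := abs_le.1 (C2.trans A1.le)
      rw [abs_le]; constructor <;> linarith
    · simp [hε.le]
  · intro x hx
    show |(γ * x * (if x ≤ a then u2 a else u2 x) + b * (if x ≤ a then p1 x else u1 x)) -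
      (γ * x * u2 x + b * u1 x)| ≤ ε
    split_ifs with hxa
    · have B4 := hbc hx (by rw [abs_of_nonneg hx]; linarith)
      have B1 : |x * u2 x| ≤ δ := by
        rcases hx.eq_or_lt with rfl | hx'
        · simp [hδ.le]
        · exact (h hx' (by rw [abs_of_nonneg hx]; linarith)).le
      have C1 : |x * u2 a| ≤ |a * u2 a| := by
        rw [abs_mul, abs_mul]
        refine mul_le_mul_of_nonneg_right ?_ (abs_nonneg _)
        rw [abs_of_pos ha0, abs_of_nonneg hx]; exact hxa
      have C2 : |u2 a * (x - a)| ≤ |a * u2 a| := by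
        rw [abs_mul, abs_mul, mul_comm]
        refine mul_le_mul_of_nonneg_right ?_ (abs_nonneg _)
        rw [abs_of_pos ha0, abs_le]; constructor <;> linarith
      have e : (γ * x * u2 a + b * p1 x) - (γ * x * u2 x + b * u1 x) =
        γ * (x * u2 a) - γ * (x * u2 x) + (b * u1 a - b * u1 0) - (b * u1 x - b * u1 0)
          + b * (u2 a * (x - a)) := by
        simp only [hp1]; ring
      rw [e]
      rw [abs_lt] at A4 B4
      have C1 := abs_le.1 (C1.trans A1.le)
      have C2 := abs_le.1 (C2.trans A1.le)
      have B1 := abs_le.1 B1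
      have D1 := mul_le_mul_of_nonneg_left C1.1 hγ.le
      have D2 := mul_le_mul_of_nonneg_left C1.2 hγ.le
      have D3 := mul_le_mul_of_nonneg_left C2.1 hb
      have D4 := mul_le_mul_of_nonneg_left C2.2 hb
      have D5 := mul_le_mul_of_nonneg_left B1.1 hγ.le
      have D6 := mul_le_mul_of_nonneg_left B1.2 hγ.le
      rw [abs_le]; constructor <;> linarith
    · simp [hε.le]
  · intro x hx
    have : ¬ x ≤ a := by linarith
    simp [this]

theorem cutoff_exists : ∃ (φ φ1 φ2 : ℝ → ℝ) (C : ℝ), (∀ x, HasDerivAt φ (φ1 x) x) ∧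
    (∀ x, HasDerivAt φ1 (φ2 x) x) ∧ Continuous φ2 ∧ 0 < C ∧
    (∀ x, x < 1 → 0 ≤ x → φ x = 1 ∧ φ1 x = 0 ∧ φ2 x = 0) ∧ (∀ x, 2 ≤ x → φ x = 0) ∧
    (∀ x, |φ x - 1| ≤ 1) ∧ (∀ x, |φ1 x| ≤ C) ∧ (∀ x, |x * φ1 x| ≤ C) ∧ (∀ x, |x * φ2 x| ≤ C) := by
  let f : ContDiffBump (0 : ℝ) := ⟨1, 2, by norm_num, by norm_num⟩
  have hf : ContDiff ℝ 2 f := f.contDiff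
  have hf' : ContDiff ℝ (1 + 1) f := by simpa [one_add_one_eq_two] using hf
  have hf1 : ContDiff ℝ 1 (deriv f) := (contDiff_succ_iff_deriv.1 hf').2.2
  have hc1 : Continuous (deriv f) := hf1.continuous
  have hc2 : Continuous (deriv (deriv f)) := (contDiff_one_iff_deriv.1 hf1).2
  have s0 : HasCompactSupport f := f.hasCompactSupport
  have s1 : HasCompactSupport (deriv f) := s0.deriv
  have s2 : HasCompactSupport (deriv (deriv f)) := s1.deriv
  obtain ⟨C1, hC1⟩ := hc1.bounded_above_of_compact_support s1
  obtain ⟨C2, hC2⟩ := (continuous_id'.mul hc1).bounded_above_of_compact_support (HasCompactSupport.mul_left s1)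
  obtain ⟨C3, hC3⟩ := (continuous_id'.mul hc2).bounded_above_of_compact_support (HasCompactSupport.mul_left s2)
  have ev : ∀ x : ℝ, x < 1 → 0 ≤ x → f =ᶠ[𝓝 x] fun _ => 1 := by
    intro x hx hx0
    filter_upwards [Ioo_mem_nhds (show -1 < x by linarith) hx] with y hy
    apply f.one_of_mem_closedBall
    simp only [Metric.mem_closedBall, Real.dist_eq, sub_zero]
    exact abs_le.2 ⟨hy.1.le, hy.2.le⟩
  refine ⟨f, deriv f, deriv (deriv f), max 1 (max C1 (max C2 C3)), ?_, ?_, hc2, by positivity,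
    ?_, ?_, ?_, ?_, ?_, ?_⟩
  · exact fun x => (hf.differentiable (by norm_num) x).hasDerivAt
  · exact fun x => (hf1.differentiable (by norm_num) x).hasDerivAt
  · intro x hx hx0
    have e := ev x hx hx0
    have e1 := e.deriv
    have e2 := e1.deriv
    exact ⟨e.self_of_nhds, by simpa using e1.self_of_nhds, by simpa using e2.self_of_nhds⟩
  · intro x hx
    apply f.zero_of_le_dist
    simp only [Real.dist_eq, sub_zero]
    exact le_trans hx (le_abs_self x)
  · intro x
    have := f.nonneg (x := x)
    have := f.le_one (x := x)
    rw [abs_le]; constructor <;> linarith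
  · intro x; exact (hC1 x).trans (le_max_of_le_right (le_max_left _ _))
  · intro x; exact (hC2 x).trans (le_max_of_le_right (le_max_of_le_right (le_max_left _ _)))
  · intro x; exact (hC3 x).trans (le_max_of_le_right (le_max_of_le_right (le_max_right _ _)))

theorem near_infty {γ b l : ℝ} (hγ : 0 < γ) (hb : 0 ≤ b) {w w1 w2 : ℝ → ℝ}
    (h1 : ∀ x, HasDerivAt w (w1 x) x) (h2 : ∀ x, HasDerivAt w1 (w2 x) x) (h2c : Continuous w2)
    (hl : Tendsto w atTop (𝓝 l)) (hl1 : Tendsto w1 atTop (𝓝 0))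
    (h : Tendsto (fun x => γ * x * w2 x + b * w1 x) atTop (𝓝 0)) (ε : ℝ) (hε : 0 < ε) :
    ∃ U U1 U2 : ℝ → ℝ, (∀ x, HasDerivAt U (U1 x) x) ∧ (∀ x, HasDerivAt U1 (U2 x) x) ∧
      Continuous U2 ∧ (∃ K, ∀ x ≥ K, U x = U K) ∧ (∀ x, 0 ≤ x → |U x - w x| ≤ ε) ∧
      (∀ x, 0 ≤ x → |(γ * x * U2 x + b * U1 x) - (γ * x * w2 x + b * w1 x)| ≤ ε) := by
  obtain ⟨φ, φ1, φ2, C, d1φ, d2φ, cφ, hC, hlow, hhigh, b0, b1, b2, b3⟩ := cutoff_exists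
  obtain ⟨δ, hδ, hδ1, hδ2⟩ : ∃ δ > 0, δ ≤ ε ∧ (1 + 3 * γ * C + b * C) * δ ≤ ε := by
    have hp : 0 < 1 + 3 * γ * C + b * C := by positivity
    refine ⟨min ε (ε / (1 + 3 * γ * C + b * C)), by positivity, min_le_left _ _, ?_⟩
    have := min_le_right ε (ε / (1 + 3 * γ * C + b * C))
    rw [le_div_iff₀ hp] at this
    linarith
  rw [Metric.tendsto_atTop] at h hl hl1
  obtain ⟨r1, hr1⟩ := h δ hδ
  obtain ⟨r2, hr2⟩ := hl δ hδ
  obtain ⟨r3, hr3⟩ := hl1 δ hδ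
  simp only [Real.dist_eq, sub_zero] at hr1 hr2 hr3
  obtain ⟨N, hN⟩ : ∃ N, N = max 1 (max r1 (max r2 r3)) := ⟨_, rfl⟩
  have hN1 : 1 ≤ N := by rw [hN]; simp
  have hNr1 : r1 ≤ N := by rw [hN]; simp
  have hNr2 : r2 ≤ N := by rw [hN]; simp
  have hNr3 : r3 ≤ N := by rw [hN]; simp
  clear hN
  have hN0 : 0 < N := by linarith
  have dsc : ∀ x : ℝ, HasDerivAt (fun x => x / N) (1 / N) x := fun x =>
    (hasDerivAt_id x).div_const N
  have D1 : ∀ x, HasDerivAt (fun x => φ (x / N)) (φ1 (x / N) / N) x := fun x =>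
    ((d1φ (x / N)).comp x (dsc x)).congr_deriv (by ring)
  have D2 : ∀ x, HasDerivAt (fun x => φ1 (x / N) / N) (φ2 (x / N) / N ^ 2) x := fun x =>
    (((d2φ (x / N)).comp x (dsc x)).div_const N).congr_deriv (by field_simp)
  have cw : Continuous w := continuous_iff_continuousAt.2 fun x => (h1 x).continuousAt
  have cw1 : Continuous w1 := continuous_iff_continuousAt.2 fun x => (h2 x).continuousAt
  have cφ0 : Continuous φ := continuous_iff_continuousAt.2 fun x => (d1φ x).continuousAt
  have cφ1 : Continuous φ1 := continuous_iff_continuousAt.2 fun x => (d2φ x).continuousAt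
  refine ⟨fun x => l + (w x - l) * φ (x / N),
    fun x => w1 x * φ (x / N) + (w x - l) * (φ1 (x / N) / N),
    fun x => w2 x * φ (x / N) + 2 * w1 x * (φ1 (x / N) / N) + (w x - l) * (φ2 (x / N) / N ^ 2),
    ?_, ?_, ?_, ?_, ?_, ?_⟩
  · intro x
    exact (((h1 x).sub_const l).mul (D1 x)).const_add l
  · intro x
    refine (((h2 x).mul (D1 x)).add (((h1 x).sub_const l).mul (D2 x))).congr_deriv ?_
    ring
  · fun_prop
  · refine ⟨2 * N, fun x hx => ?_⟩
    simp only
    rw [hhigh (x / N) (by rw [le_div_iff₀ hN0]; exact hx),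
      hhigh (2 * N / N) (by rw [le_div_iff₀ hN0])]
    simp
  · intro x hx
    have e : l + (w x - l) * φ (x / N) - w x = (w x - l) * (φ (x / N) - 1) := by ring
    simp only
    rw [e]
    rcases lt_or_ge x N with hxN | hxN
    · rw [(hlow (x / N) (by rwa [div_lt_one hN0]) (by positivity)).1]
      simp [hε.le]
    · rw [abs_mul]
      have := hr2 x (by linarith)
      have := b0 (x / N)
      have := abs_nonneg (w x - l)
      nlinarith
  · intro x hx
    simp only
    rcases lt_or_ge x N with hxN | hxN
    · obtain ⟨e0, e1, e2⟩ := hlow (x / N) (by rwa [div_lt_one hN0]) (by positivity)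
      rw [e0, e1, e2]
      simp [hε.le]
    · set t := x / N with ht
      have hxt : x = t * N := by rw [ht]; field_simp
      have e : (γ * x * (w2 x * φ t + 2 * w1 x * (φ1 t / N) + (w x - l) * (φ2 t / N ^ 2)) +
          b * (w1 x * φ t + (w x - l) * (φ1 t / N))) - (γ * x * w2 x + b * w1 x) =
          (γ * x * w2 x + b * w1 x) * (φ t - 1) + 2 * γ * (w1 x * (t * φ1 t))
          + γ * ((w x - l) / N * (t * φ2 t)) + b * ((w x - l) / N * φ1 t) := by
        have hx1 : x / N = t := rfl
        have hx2 : x / N ^ 2 = t / N := by rw [ht]; field_simp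
        linear_combination (2 * γ * w1 x * φ1 t) * hx1 + γ * (w x - l) * φ2 t * hx2
      rw [e]
      have E1 : |(γ * x * w2 x + b * w1 x) * (φ t - 1)| ≤ δ * 1 := by
        rw [abs_mul]
        exact mul_le_mul (hr1 x (by linarith)).le (b0 t) (abs_nonneg _) hδ.le
      have E2 : |w1 x * (t * φ1 t)| ≤ δ * C := by
        rw [abs_mul]
        exact mul_le_mul (hr3 x (by linarith)).le (b2 t) (abs_nonneg _) hδ.le
      have hwl : |(w x - l) / N| ≤ δ := by
        rw [abs_div, abs_of_pos hN0]
        exact (div_le_self (abs_nonneg _) hN1).trans (hr2 x (by linarith)).le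
      have E3 : |(w x - l) / N * (t * φ2 t)| ≤ δ * C := by
        rw [abs_mul]
        exact mul_le_mul hwl (b3 t) (abs_nonneg _) hδ.le
      have E4 : |(w x - l) / N * φ1 t| ≤ δ * C := by
        rw [abs_mul]
        exact mul_le_mul hwl (b1 t) (abs_nonneg _) hδ.le
      have F2 := mul_le_mul_of_nonneg_left E2 (show 0 ≤ 2 * γ by positivity)
      have F3 := mul_le_mul_of_nonneg_left E3 hγ.le
      have F4 := mul_le_mul_of_nonneg_left E4 hb
      refine (abs_add_le _ _).trans ?_
      refine (add_le_add_left (abs_add_le _ _) _).trans ?_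
      refine (add_le_add_left (add_le_add_left (abs_add_le _ _) _) _).trans ?_
      rw [abs_mul (2 * γ), abs_mul γ, abs_mul b, abs_of_pos (show 0 < 2 * γ by positivity),
        abs_of_pos hγ, abs_of_nonneg hb]
      linarith

theorem approx_one {γ b : ℝ} (hγ : 0 < γ) (hb : 0 ≤ b) {u : ℝ → ℝ}
    (hu : memDomain γ b u) (ε : ℝ) (hε : 0 < ε) :
    ∃ U : ℝ → ℝ, (ContDiffOn ℝ 2 U (Ici 0) ∧ ∃ K, ∀ x ≥ K, U x = U K) ∧
      (∀ x, 0 ≤ x → |U x - u x| ≤ ε) ∧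
      (∀ x, 0 ≤ x → |(γ * x * d2 U x + b * d1 U x) - (γ * x * d2 u x + b * d1 u x)| ≤ ε) := by
  obtain ⟨hc, hcd, ⟨l, hl⟩, h0, hbc, hinf⟩ : ContinuousWithinAt u (Ici 0) 0 ∧
      ContDiffOn ℝ 2 u (Ioi 0) ∧ (∃ l, Tendsto u atTop (𝓝 l)) ∧
      Tendsto (fun x => x * d2 u x) (𝓝[>] 0) (𝓝 0) ∧
      ContinuousWithinAt (fun x => b * d1 u x) (Ici 0) 0 ∧
      Tendsto (fun x => γ * x * d2 u x + b * d1 u x) atTop (𝓝 0) := by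
    rcases hu with ⟨hb0, hc1, hc2, hl, h0, hinf⟩ | ⟨rfl, hc, hc2, hl, h0, hinf⟩
    · refine ⟨hc1.continuousOn 0 self_mem_Ici, hc2, hl, h0, ?_, hinf⟩
      exact ((hc1.continuousOn_derivWithin (uniqueDiffOn_Ici 0) le_rfl) 0 self_mem_Ici).const_mul b
    · refine ⟨hc 0 self_mem_Ici, hc2, hl, ?_, ?_, by simpa using hinf⟩
      · have := h0.const_mul γ⁻¹
        simp only [mul_zero] at this
        refine this.congr (fun x => ?_)
        field_simp
      · simpa using continuousWithinAt_const
  obtain ⟨D1, D2, D2c⟩ := pos_facts hcd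
  have hd1 := d1_atTop hγ hb hl D1 D2 hinf
  obtain ⟨w, w1, w2, W1, W2, W2c, Wu, WA, Weq⟩ :=
    near_zero hγ hb hc D1 D2 D2c h0 hbc (ε / 2) (by positivity)
  have ev : ∀ᶠ x : ℝ in atTop, 1 < x := eventually_gt_atTop 1
  obtain ⟨U, U1, U2, V1, V2, V2c, VK, Vw, VA⟩ := near_infty (l := l) hγ hb W1 W2 W2c
    (hl.congr' (by filter_upwards [ev] with x hx using (Weq x hx).1.symm))
    (hd1.congr' (by filter_upwards [ev] with x hx using (Weq x hx).2.1.symm))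
    (hinf.congr' (by filter_upwards [ev] with x hx; rw [(Weq x hx).2.1, (Weq x hx).2.2]))
    (ε / 2) (by positivity)
  obtain ⟨S, S1, S2⟩ := smooth_facts V1 V2 V2c
  refine ⟨U, ⟨S.contDiffOn, VK⟩, fun x hx => ?_, fun x hx => ?_⟩
  · have := abs_sub_le (U x) (w x) (u x)
    linarith [Vw x hx, Wu x hx]
  · rw [S1 x hx, S2 x hx]
    have := abs_sub_le (γ * x * U2 x + b * U1 x) (γ * x * w2 x + b * w1 x)
      (γ * x * d2 u x + b * d1 u x)
    linarith [VA x hx, WA x hx]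

/-- Let `γ > 0`, `b ≥ 0` and `u ∈ D(A^{γ,b})`. Then there is a sequence `(u_n)` of functions,
each `C²` on `[0,∞)` and constant on some `[K_n,∞)`, with `u_n → u` uniformly on `[0,∞)` and
`γ x u_n''(x) + b u_n'(x) → γ x u''(x) + b u'(x)` uniformly on `[0,∞)`. -/
theorem stmt15 (γ b : ℝ) (hγ : 0 < γ) (hb : 0 ≤ b) (u : ℝ → ℝ)
    (hu : memDomain γ b u) :
    ∃ U : ℕ → ℝ → ℝ,
      (∀ n, ContDiffOn ℝ 2 (U n) (Set.Ici 0) ∧ ∃ K, ∀ x ≥ K, U n x = U n K) ∧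
      TendstoUniformlyOn (fun n x => U n x) u Filter.atTop (Set.Ici 0) ∧
      TendstoUniformlyOn (fun n x => γ * x * d2 (U n) x + b * d1 (U n) x)
        (fun x => γ * x * d2 u x + b * d1 u x) Filter.atTop (Set.Ici 0) := by
  choose U hU hU1 hU2 using fun n : ℕ =>
    approx_one hγ hb hu (1 / ((n : ℝ) + 1)) Nat.one_div_pos_of_nat
  have ht := tendsto_one_div_add_atTop_nhds_zero_nat (𝕜 := ℝ)
  refine ⟨U, hU, ?_, ?_⟩
  · rw [Metric.tendstoUniformlyOn_iff]
    intro ε hε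
    filter_upwards [ht.eventually_lt_const hε] with n hn x hx
    rw [dist_comm, Real.dist_eq]
    exact (hU1 n x hx).trans_lt hn
  · rw [Metric.tendstoUniformlyOn_iff]
    intro ε hε
    filter_upwards [ht.eventually_lt_const hε] with n hn x hx
    rw [dist_comm, Real.dist_eq]
    exact (hU2 n x hx).trans_lt hn
end

section
/- There exists a constant C > 0 such that for all γ > 0, b > 0, λ > 0 and every f ∈ C([0,∞]), the function R_λ f : x ↦ ∫_0^∞ e^{−λt} P_t^{γ,b} f(x) dt is differentiable on [0,∞) and for every x ≥ 0 one has | (R_λ f)'(x) | ≤ (1/γ) · max{2, γ/b} · C · ‖f‖_∞. -/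
open MeasureTheory

section Aux

open Set Filter Topology

lemma aux_int {a γ t M : ℝ} (ha : 0 < a) (hγ : 0 < γ) (ht : 0 < t) {f : ℝ → ℝ}
    (hf : ContinuousOn f (Ici 0)) (hM : ∀ y ≥ (0:ℝ), |f y| ≤ M) (m : ℕ) :
    IntegrableOn (fun z => Real.exp (-z) * z ^ ((m : ℝ) + a - 1) * f (γ * z * t)) (Ioi 0) := by
  have h1 : IntegrableOn (fun z => Real.exp (-z) * z ^ ((m : ℝ) + a - 1)) (Ioi 0) :=
    Real.GammaIntegral_convergent (by positivity)
  have hmap : ∀ z ∈ Ioi (0:ℝ), γ * z * t ∈ Ici (0:ℝ) := fun z hz => by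
    have : 0 < z := hz
    exact (by positivity : 0 ≤ γ * z * t)
  refine Integrable.mul_bdd (c := M) h1 ?_ ?_
  · refine ContinuousOn.aestronglyMeasurable ?_ measurableSet_Ioi
    exact hf.comp (by fun_prop) hmap
  · refine (ae_restrict_iff' measurableSet_Ioi).2 (Eventually.of_forall fun z hz => ?_)
    exact hM _ (hmap z hz)

lemma aux_bd {a γ t M : ℝ} (ha : 0 < a) (hγ : 0 < γ) (ht : 0 < t) {f : ℝ → ℝ}
    (hM : ∀ y ≥ (0:ℝ), |f y| ≤ M) (m : ℕ) :
    |∫ z in Ioi (0:ℝ), Real.exp (-z) * z ^ ((m : ℝ) + a - 1) * f (γ * z * t)|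
      ≤ M * Real.Gamma (m + a) := by
  have h1 : IntegrableOn (fun z => Real.exp (-z) * z ^ ((m : ℝ) + a - 1)) (Ioi 0) :=
    Real.GammaIntegral_convergent (by positivity)
  rw [Real.Gamma_eq_integral (by positivity), ← integral_const_mul, ← Real.norm_eq_abs]
  refine norm_integral_le_of_norm_le (h1.const_mul M) ?_
  refine (ae_restrict_iff' measurableSet_Ioi).2 (Eventually.of_forall fun z hz => ?_)
  have hz' : 0 < z := hz
  have := hM (γ * z * t) (by positivity)
  rw [norm_mul, Real.norm_of_nonneg (by positivity), mul_comm M]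
  exact mul_le_mul_of_nonneg_left this (by positivity)

lemma aux_term_s19 {a γ t M x : ℝ} (ha : 0 < a) (hγ : 0 < γ) (ht : 0 < t) (hx : 0 ≤ x) {f : ℝ → ℝ}
    (hM : ∀ y ≥ (0:ℝ), |f y| ≤ M) (m : ℕ) :
    ‖(x / (γ * t)) ^ m * (1 / ((m.factorial : ℝ) * Real.Gamma ((m : ℝ) + a))) *
      ∫ z in Ioi (0:ℝ), Real.exp (-z) * z ^ ((m : ℝ) + a - 1) * f (γ * z * t)‖
      ≤ M * ((x / (γ * t)) ^ m / m.factorial) := by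
  have hG : 0 < Real.Gamma (m + a) := Real.Gamma_pos_of_pos (by positivity)
  have hf : (0:ℝ) < m.factorial := by positivity
  rw [norm_mul, Real.norm_of_nonneg (by positivity)]
  calc _ ≤ (x / (γ * t)) ^ m * (1 / ((m.factorial : ℝ) * Real.Gamma ((m : ℝ) + a))) *
        (M * Real.Gamma (m + a)) :=
        mul_le_mul_of_nonneg_left (aux_bd ha hγ ht hM m) (by positivity)
    _ = _ := by field_simp

lemma aux_summable {a γ t M x : ℝ} (ha : 0 < a) (hγ : 0 < γ) (ht : 0 < t) (hx : 0 ≤ x) {f : ℝ → ℝ}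
    (hM : ∀ y ≥ (0:ℝ), |f y| ≤ M) :
    Summable fun m : ℕ => (x / (γ * t)) ^ m * (1 / ((m.factorial : ℝ) * Real.Gamma ((m : ℝ) + a))) *
      ∫ z in Ioi (0:ℝ), Real.exp (-z) * z ^ ((m : ℝ) + a - 1) * f (γ * z * t) :=
  Summable.of_norm_bounded ((Real.summable_pow_div_factorial _).mul_left M)
    (aux_term_s19 ha hγ ht hx hM)

lemma exp_hasSum (u : ℝ) : HasSum (fun m : ℕ => u ^ m / m.factorial) (Real.exp u) := by
  rw [Real.exp_eq_exp_ℝ]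
  exact NormedSpace.expSeries_div_hasSum_exp u

lemma psem_bd {γ b t M x : ℝ} (hγ : 0 < γ) (hb : 0 < b) (ht : 0 < t) (hx : 0 ≤ x) {f : ℝ → ℝ}
    (hM : ∀ y ≥ (0:ℝ), |f y| ≤ M) : |Psem γ b t f x| ≤ M := by
  have ha : 0 < b / γ := by positivity
  unfold Psem
  rw [abs_mul, abs_of_pos (Real.exp_pos _)]
  have := tsum_of_norm_bounded ((exp_hasSum (x / (γ * t))).mul_left M) (aux_term_s19 ha hγ ht hx hM)
  calc _ ≤ Real.exp (-x / (γ * t)) * (M * Real.exp (x / (γ * t))) :=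
        mul_le_mul_of_nonneg_left this (Real.exp_pos _).le
    _ = M := by rw [mul_left_comm, ← Real.exp_add, neg_div, neg_add_cancel, Real.exp_zero, mul_one]

lemma psem_add {γ b t M N x : ℝ} (hγ : 0 < γ) (hb : 0 < b) (ht : 0 < t) (hx : 0 ≤ x) {f g : ℝ → ℝ}
    (hf : ContinuousOn f (Ici 0)) (hg : ContinuousOn g (Ici 0))
    (hM : ∀ y ≥ (0:ℝ), |f y| ≤ M) (hN : ∀ y ≥ (0:ℝ), |g y| ≤ N) :
    Psem γ b t (fun y => f y + g y) x = Psem γ b t f x + Psem γ b t g x := by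
  have ha : 0 < b / γ := by positivity
  unfold Psem
  rw [← mul_add, ← (aux_summable ha hγ ht hx hM).tsum_add (aux_summable ha hγ ht hx hN)]
  refine congrArg (Real.exp (-x / (γ * t)) * ·) (tsum_congr fun m => ?_)
  rw [← mul_add, ← integral_add (aux_int ha hγ ht hf hM m) (aux_int ha hγ ht hg hN m)]
  simp only [mul_add]

lemma psem_smul {γ b t x : ℝ} (c : ℝ) {f : ℝ → ℝ} :
    Psem γ b t (fun y => c * f y) x = c * Psem γ b t f x := by
  unfold Psem
  rw [mul_left_comm c, ← tsum_mul_left (a := c)]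
  refine congrArg (Real.exp (-x / (γ * t)) * ·) (tsum_congr fun m => ?_)
  have h : (∫ z in Ioi (0:ℝ), Real.exp (-z) * z ^ ((m : ℝ) + b / γ - 1) * (c * f (γ * z * t))) =
      c * ∫ z in Ioi (0:ℝ), Real.exp (-z) * z ^ ((m : ℝ) + b / γ - 1) * f (γ * z * t) := by
    rw [← integral_const_mul]
    simp only [mul_left_comm c]
  rw [h]
  ring

lemma psem_exp {γ b t x μ : ℝ} (hγ : 0 < γ) (hb : 0 < b) (ht : 0 < t) (hμ : 0 ≤ μ) :
    Psem γ b t (fun y => Real.exp (-(μ * y))) x =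
      (1 + γ * μ * t) ^ (-(b / γ)) * Real.exp (-(x * (μ / (1 + γ * μ * t)))) := by
  have ha : 0 < b / γ := by positivity
  unfold Psem
  set a := b / γ
  have hr : 0 < 1 + γ * μ * t := by positivity
  set r := 1 + γ * μ * t with hrdef
  have key : ∀ m : ℕ, (x / (γ * t)) ^ m * (1 / ((m.factorial : ℝ) * Real.Gamma ((m : ℝ) + a))) *
      (∫ z in Ioi (0:ℝ), Real.exp (-z) * z ^ ((m : ℝ) + a - 1) * Real.exp (-(μ * (γ * z * t))))
      = r ^ (-a) * ((x / (γ * t) / r) ^ m / m.factorial) := by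
    intro m
    have hG : 0 < Real.Gamma (m + a) := Real.Gamma_pos_of_pos (by positivity)
    have hf : (0:ℝ) < m.factorial := by positivity
    have h1 := Real.integral_rpow_mul_exp_neg_mul_Ioi (a := m + a) (by positivity) hr
    have h2 : (∫ z in Ioi (0:ℝ), Real.exp (-z) * z ^ ((m : ℝ) + a - 1) *
        Real.exp (-(μ * (γ * z * t)))) = (1 / r) ^ (m + a) * Real.Gamma (m + a) := by
      rw [← h1]
      congr 1
      ext z
      rw [mul_right_comm, ← Real.exp_add, mul_comm]
      congr 2
      rw [hrdef]; ring
    rw [h2, Real.rpow_add (by positivity), Real.rpow_natCast, one_div r, Real.inv_rpow hr.le,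
      ← Real.rpow_neg hr.le]
    field_simp
    rw [← mul_pow]
    congr 1
    field_simp
  simp only [key]
  rw [tsum_mul_left, (exp_hasSum _).tsum_eq, mul_left_comm, ← Real.exp_add]
  congr 2
  field_simp
  rw [hrdef]; ring

/-- integrand for exponentials -/
noncomputable def FJ (γ b lam μ : ℝ) (k : ℕ) (x t : ℝ) : ℝ :=
  Real.exp (-lam * t) * ((μ / (1 + γ * μ * t)) ^ k *
    ((1 + γ * μ * t) ^ (-(b / γ)) * Real.exp (-(x * (μ / (1 + γ * μ * t))))))

lemma FJ_bd {γ b lam μ : ℝ} (hγ : 0 < γ) (hb : 0 < b) (hμ : 0 ≤ μ) (k : ℕ) {x X t : ℝ}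
    (hX : |x| ≤ X) (ht : 0 ≤ t) :
    ‖FJ γ b lam μ k x t‖ ≤ μ ^ k * Real.exp (X * μ) * Real.exp (-lam * t) := by
  have hr : 1 ≤ 1 + γ * μ * t := by have : 0 ≤ γ * μ * t := by positivity
                                    linarith
  unfold FJ
  set r := 1 + γ * μ * t
  have hr0 : 0 < r := by linarith
  have hw : μ / r ≤ μ := div_le_self hμ hr
  have hw0 : 0 ≤ μ / r := by positivity
  have h1 : r ^ (-(b / γ)) ≤ 1 :=
    Real.rpow_le_one_of_one_le_of_nonpos hr (by have : 0 < b / γ := by positivity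
                                                linarith)
  have h2 : Real.exp (-(x * (μ / r))) ≤ Real.exp (X * μ) := by
    apply Real.exp_le_exp.2
    have : -x ≤ X := (neg_le_abs x).trans hX
    have hX0 : 0 ≤ X := (abs_nonneg x).trans hX
    calc -(x * (μ / r)) = (-x) * (μ / r) := by ring
      _ ≤ X * (μ / r) := mul_le_mul_of_nonneg_right this hw0
      _ ≤ X * μ := mul_le_mul_of_nonneg_left hw hX0
  rw [Real.norm_of_nonneg (by positivity)]
  have h3 : (μ / r) ^ k ≤ μ ^ k := pow_le_pow_left₀ hw0 hw k
  have h4 : r ^ (-(b / γ)) * Real.exp (-(x * (μ / r))) ≤ 1 * Real.exp (X * μ) :=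
    mul_le_mul h1 h2 (Real.exp_pos _).le zero_le_one
  rw [one_mul] at h4
  calc _ ≤ Real.exp (-lam * t) * (μ ^ k * Real.exp (X * μ)) :=
        mul_le_mul_of_nonneg_left (mul_le_mul h3 h4 (by positivity) (by positivity))
          (Real.exp_pos _).le
    _ = _ := by ring

lemma expInt {lam : ℝ} (hl : 0 < lam) : IntegrableOn (fun t => Real.exp (-lam * t)) (Ioi 0) :=
  integrableOn_exp_mul_Ioi (by linarith) 0

lemma FJ_meas {γ b lam μ : ℝ} (hγ : 0 < γ) (hμ : 0 ≤ μ) (k : ℕ) (x : ℝ) :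
    AEStronglyMeasurable (FJ γ b lam μ k x) (volume.restrict (Ioi 0)) := by
  refine ContinuousOn.aestronglyMeasurable ?_ measurableSet_Ioi
  have hr : ∀ t ∈ Ioi (0:ℝ), 1 + γ * μ * t ≠ 0 := fun t ht => by
    have : 0 < t := ht
    positivity
  have hw : ContinuousOn (fun t : ℝ => μ / (1 + γ * μ * t)) (Ioi 0) :=
    ContinuousOn.div continuousOn_const (by fun_prop) hr
  unfold FJ
  refine ContinuousOn.mul (by fun_prop) ((hw.pow k).mul (ContinuousOn.mul ?_ ?_))
  · exact ContinuousOn.rpow_const (by fun_prop) (fun t ht => Or.inl (hr t ht))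
  · exact Real.continuous_exp.comp_continuousOn (continuousOn_const.mul hw).neg

lemma FJ_int {γ b lam μ : ℝ} (hγ : 0 < γ) (hb : 0 < b) (hl : 0 < lam) (hμ : 0 ≤ μ) (k : ℕ) (x : ℝ) :
    IntegrableOn (FJ γ b lam μ k x) (Ioi 0) := by
  refine Integrable.mono' ((expInt hl).const_mul (μ ^ k * Real.exp (|x| * μ)))
    (FJ_meas hγ hμ k x) ?_
  exact (ae_restrict_iff' measurableSet_Ioi).2 (Eventually.of_forall fun t ht =>
    FJ_bd hγ hb hμ k le_rfl (le_of_lt ht))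

noncomputable def JJ (γ b lam μ : ℝ) (k : ℕ) (x : ℝ) : ℝ := ∫ t in Ioi (0:ℝ), FJ γ b lam μ k x t

lemma JJ_deriv {γ b lam μ : ℝ} (hγ : 0 < γ) (hb : 0 < b) (hl : 0 < lam) (hμ : 0 ≤ μ) (k : ℕ) (x : ℝ) :
    HasDerivAt (JJ γ b lam μ k) (-JJ γ b lam μ (k + 1) x) x := by
  have := hasDerivAt_integral_of_dominated_loc_of_deriv_le (μ := volume.restrict (Ioi (0:ℝ)))
    (F := FJ γ b lam μ k) (F' := fun x t => - FJ γ b lam μ (k + 1) x t) (x₀ := x)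
    (s := Metric.ball x 1)
    (bound := fun t => μ ^ (k+1) * Real.exp ((|x| + 1) * μ) * Real.exp (-lam * t))
    (Metric.ball_mem_nhds x one_pos)
    (Eventually.of_forall fun y => FJ_meas hγ hμ k y) (FJ_int hγ hb hl hμ k x)
    (FJ_meas hγ hμ (k+1) x).neg ?_ ((expInt hl).const_mul _) ?_
  · have h2 := this.2
    rw [integral_neg] at h2
    exact h2
  · refine (ae_restrict_iff' measurableSet_Ioi).2 (Eventually.of_forall fun t ht y hy => ?_)
    rw [norm_neg]
    refine FJ_bd hγ hb hμ (k+1) ?_ (le_of_lt ht)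
    rw [Metric.mem_ball, Real.dist_eq] at hy
    have := abs_sub_abs_le_abs_sub y x
    linarith
  · refine Eventually.of_forall fun t y hy => ?_
    unfold FJ
    have h0 : HasDerivAt (fun y : ℝ => -(y * (μ / (1 + γ * μ * t)))) (-(1 * (μ / (1 + γ * μ * t)))) y :=
      ((hasDerivAt_id y).mul_const (μ / (1 + γ * μ * t))).neg
    have h := (((h0.exp).const_mul
      ((1 + γ * μ * t) ^ (-(b / γ)))).const_mul ((μ / (1 + γ * μ * t)) ^ k)).const_mul
      (Real.exp (-lam * t))
    refine h.congr_deriv ?_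
    ring

lemma JJ_ode {γ b lam μ : ℝ} (hγ : 0 < γ) (hb : 0 < b) (hl : 0 < lam) (hμ : 0 ≤ μ) (x : ℝ) :
    γ * x * JJ γ b lam μ 2 x - b * JJ γ b lam μ 1 x =
      lam * JJ γ b lam μ 0 x - Real.exp (-(μ * x)) := by
  have hi := fun k => FJ_int hγ hb hl hμ k x
  have hd : ∀ t ∈ Ici (0:ℝ), HasDerivAt (FJ γ b lam μ 0 x)
      (γ * x * FJ γ b lam μ 2 x t - b * FJ γ b lam μ 1 x t - lam * FJ γ b lam μ 0 x t) t := by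
    intro t ht
    have ht0 : 0 ≤ t := ht
    have hr : 0 < 1 + γ * μ * t := by positivity
    have hrd : HasDerivAt (fun t : ℝ => 1 + γ * μ * t) (γ * μ) t := by
      simpa using ((hasDerivAt_id t).const_mul (γ * μ)).const_add 1
    have hw : HasDerivAt (fun t : ℝ => -(x * (μ / (1 + γ * μ * t))))
        (-(x * ((0 * (1 + γ * μ * t) - μ * (γ * μ)) / (1 + γ * μ * t) ^ 2))) t :=
      (((hasDerivAt_const t μ).div hrd hr.ne').const_mul x).neg
    have hp := hrd.rpow_const (p := -(b / γ)) (Or.inl hr.ne')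
    have he : HasDerivAt (fun t : ℝ => Real.exp (-lam * t)) (Real.exp (-lam * t) * (-lam)) t := by
      simpa using ((hasDerivAt_id t).const_mul (-lam)).exp
    have h := he.mul (hp.mul hw.exp)
    have h' := h.congr_of_eventuallyEq (f₁ := FJ γ b lam μ 0 x)
      (Eventually.of_forall fun s => by simp [FJ])
    refine h'.congr_deriv ?_
    unfold FJ
    rw [Real.rpow_sub_one hr.ne']
    simp only [Pi.mul_apply]
    generalize Real.exp (-(x * (μ / (1 + γ * μ * t)))) = E
    generalize (1 + γ * μ * t) ^ (-(b / γ)) = P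
    generalize 1 + γ * μ * t = r at hr
    field_simp
    ring
  have ht : Tendsto (FJ γ b lam μ 0 x) atTop (𝓝 0) := by
    have h0 : Tendsto (fun t => μ ^ 0 * Real.exp (|x| * μ) * Real.exp (-lam * t)) atTop (𝓝 0) := by
      have : Tendsto (fun t => Real.exp (-lam * t)) atTop (𝓝 0) :=
        Real.tendsto_exp_atBot.comp (tendsto_id.const_mul_atTop_of_neg (by linarith))
      have h := this.const_mul (μ ^ 0 * Real.exp (|x| * μ))
      rwa [mul_zero] at h
    refine squeeze_zero_norm' ?_ h0
    filter_upwards [eventually_ge_atTop 0] with t ht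
    exact FJ_bd hγ hb hμ 0 le_rfl ht
  have i2 := (hi 2).const_mul (γ * x)
  have i1 := (hi 1).const_mul b
  have i0 := (hi 0).const_mul lam
  have i21 : Integrable (fun t => γ * x * FJ γ b lam μ 2 x t - b * FJ γ b lam μ 1 x t)
    (volume.restrict (Ioi 0)) := i2.sub i1
  have := integral_Ioi_of_hasDerivAt_of_tendsto' hd (i21.sub i0) ht
  have e0 : FJ γ b lam μ 0 x 0 = Real.exp (-(μ * x)) := by simp [FJ, mul_comm]
  rw [integral_sub i21 i0, integral_sub i2 i1, integral_const_mul, integral_const_mul,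
    integral_const_mul, e0] at this
  unfold JJ
  linarith

noncomputable def Rs (γ b lam : ℝ) (f : ℝ → ℝ) (x : ℝ) : ℝ :=
  ∫ t in Ioi (0:ℝ), Real.exp (-lam * t) * Psem γ b t f x

structure Tri (γ b lam : ℝ) (f H0 H1 H2 : ℝ → ℝ) : Prop where
  cont : Continuous f
  bdd : ∃ M, ∀ y ≥ (0:ℝ), |f y| ≤ M
  hd0 : ∀ x, HasDerivAt H0 (-H1 x) x
  hd1 : ∀ x, HasDerivAt H1 (-H2 x) x
  meas : ∀ x ≥ 0, AEStronglyMeasurable (fun t => Real.exp (-lam * t) * Psem γ b t f x)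
    (volume.restrict (Ioi 0))
  eq : ∀ x ≥ 0, H0 x = Rs γ b lam f x
  ode : ∀ x ≥ 0, γ * x * H2 x - b * H1 x = lam * H0 x - f x

lemma Tri_exp {γ b lam μ : ℝ} (hγ : 0 < γ) (hb : 0 < b) (hl : 0 < lam) (hμ : 0 ≤ μ) :
    Tri γ b lam (fun y => Real.exp (-(μ * y))) (JJ γ b lam μ 0) (JJ γ b lam μ 1)
      (JJ γ b lam μ 2) := by
  have key : ∀ x t : ℝ, 0 < t →
      FJ γ b lam μ 0 x t = Real.exp (-lam * t) * Psem γ b t (fun y => Real.exp (-(μ * y))) x := by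
    intro x t ht
    rw [psem_exp hγ hb ht hμ]
    simp [FJ]
  refine ⟨by fun_prop, ⟨1, fun y hy => ?_⟩, JJ_deriv hγ hb hl hμ 0, JJ_deriv hγ hb hl hμ 1, ?_, ?_,
    fun x _ => JJ_ode hγ hb hl hμ x⟩
  · rw [abs_of_pos (Real.exp_pos _), Real.exp_le_one_iff]
    have : 0 ≤ μ * y := mul_nonneg hμ hy
    linarith
  · intro x hx
    refine (FJ_meas (b := b) (lam := lam) hγ hμ 0 x).congr ?_
    exact (ae_restrict_iff' measurableSet_Ioi).2 (Eventually.of_forall fun t ht => key x t ht)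
  · intro x hx
    exact setIntegral_congr_fun measurableSet_Ioi (fun t ht => key x t ht)

lemma Tri.integrable {γ b lam : ℝ} {f H0 H1 H2 : ℝ → ℝ} (h : Tri γ b lam f H0 H1 H2)
    (hγ : 0 < γ) (hb : 0 < b) (hl : 0 < lam) {x : ℝ} (hx : 0 ≤ x) :
    IntegrableOn (fun t => Real.exp (-lam * t) * Psem γ b t f x) (Ioi 0) := by
  obtain ⟨M, hM⟩ := h.bdd
  refine Integrable.mono' ((expInt hl).mul_const M) (h.meas x hx) ?_
  refine (ae_restrict_iff' measurableSet_Ioi).2 (Eventually.of_forall fun t ht => ?_)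
  rw [norm_mul, Real.norm_of_nonneg (Real.exp_pos _).le]
  exact mul_le_mul_of_nonneg_left (psem_bd hγ hb ht hx hM) (Real.exp_pos _).le

lemma Tri.add {γ b lam : ℝ} {f H0 H1 H2 g G0 G1 G2 : ℝ → ℝ} (h : Tri γ b lam f H0 H1 H2)
    (h' : Tri γ b lam g G0 G1 G2)
    (hγ : 0 < γ) (hb : 0 < b) (hl : 0 < lam) :
    Tri γ b lam (fun y => f y + g y) (fun y => H0 y + G0 y) (fun y => H1 y + G1 y)
      (fun y => H2 y + G2 y) := by
  obtain ⟨M, hM⟩ := h.bdd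
  obtain ⟨N, hN⟩ := h'.bdd
  have key : ∀ x ≥ 0, ∀ t > 0,
      Real.exp (-lam * t) * Psem γ b t f x + Real.exp (-lam * t) * Psem γ b t g x =
      Real.exp (-lam * t) * Psem γ b t (fun y => f y + g y) x := by
    intro x hx t ht
    rw [psem_add hγ hb ht hx h.cont.continuousOn h'.cont.continuousOn hM hN, mul_add]
  refine ⟨h.cont.add h'.cont, ⟨M + N, fun y hy => (abs_add_le _ _).trans
    (add_le_add (hM y hy) (hN y hy))⟩, fun x => ?_, fun x => ?_, fun x hx => ?_, fun x hx => ?_,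
    fun x hx => ?_⟩
  · exact ((h.hd0 x).add (h'.hd0 x)).congr_deriv (by ring)
  · exact ((h.hd1 x).add (h'.hd1 x)).congr_deriv (by ring)
  · refine ((h.meas x hx).add (h'.meas x hx)).congr ?_
    exact (ae_restrict_iff' measurableSet_Ioi).2 (Eventually.of_forall fun t ht => key x hx t ht)
  · rw [h.eq x hx, h'.eq x hx]
    unfold Rs
    rw [← integral_add (h.integrable hγ hb hl hx) (h'.integrable hγ hb hl hx)]
    exact setIntegral_congr_fun measurableSet_Ioi (fun t ht => key x hx t ht)
  · have := h.ode x hx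
    have := h'.ode x hx
    linarith

lemma Tri.smul {γ b lam : ℝ} {f H0 H1 H2 : ℝ → ℝ} (h : Tri γ b lam f H0 H1 H2) (c : ℝ) :
    Tri γ b lam (fun y => c * f y) (fun y => c * H0 y) (fun y => c * H1 y)
      (fun y => c * H2 y) := by
  obtain ⟨M, hM⟩ := h.bdd
  refine ⟨h.cont.const_mul c, ⟨|c| * M, fun y hy => ?_⟩, fun x => ?_, fun x => ?_, fun x hx => ?_,
    fun x hx => ?_, fun x hx => ?_⟩
  · rw [abs_mul]
    exact mul_le_mul_of_nonneg_left (hM y hy) (abs_nonneg c)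
  · exact ((h.hd0 x).const_mul c).congr_deriv (by ring)
  · exact ((h.hd1 x).const_mul c).congr_deriv (by ring)
  · simp only [psem_smul, mul_left_comm _ c]
    exact (h.meas x hx).const_mul c
  · simp only [Rs, psem_smul, mul_left_comm _ c]
    rw [integral_const_mul, h.eq x hx, Rs]
  · linear_combination c * h.ode x hx

lemma Tri_poly {γ b lam : ℝ} (hγ : 0 < γ) (hb : 0 < b) (hl : 0 < lam) (p : Polynomial ℝ) :
    ∃ H0 H1 H2, Tri γ b lam (fun y => p.eval (Real.exp (-y))) H0 H1 H2 := by
  induction p using Polynomial.induction_on' with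
  | add p q hp hq =>
    obtain ⟨H0, H1, H2, h⟩ := hp
    obtain ⟨G0, G1, G2, h'⟩ := hq
    have h2 := h.add h' hγ hb hl
    simp only [← Polynomial.eval_add] at h2
    exact ⟨_, _, _, h2⟩
  | monomial n c =>
    have h := (Tri_exp (μ := n) hγ hb hl (by positivity)).smul c
    refine ⟨_, _, _, (?_ : Tri γ b lam _ (fun y => c * JJ γ b lam n 0 y)
      (fun y => c * JJ γ b lam n 1 y) (fun y => c * JJ γ b lam n 2 y))⟩
    simp only [Polynomial.eval_monomial, ← Real.exp_nat_mul, mul_neg]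
    exact h

lemma Tri.bound {γ b lam M : ℝ} {f H0 H1 H2 : ℝ → ℝ} (h : Tri γ b lam f H0 H1 H2)
    (hγ : 0 < γ) (hb : 0 < b) (hl : 0 < lam) (hM : ∀ y ≥ (0:ℝ), |f y| ≤ M) {x : ℝ} (hx : 0 ≤ x) :
    |H1 x| ≤ 2 / b * M := by
  have h0 : ∀ x ≥ 0, |lam * H0 x| ≤ M := by
    intro x hx
    have : |H0 x| ≤ M / lam := by
      rw [h.eq x hx, Rs, ← Real.norm_eq_abs]
      have e : ∫ t in Ioi (0:ℝ), Real.exp (-lam * t) * M = M / lam := by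
        rw [integral_mul_const, integral_exp_mul_Ioi (by linarith)]
        simp; field_simp
      rw [← e]
      refine norm_integral_le_of_norm_le ((expInt hl).mul_const M) ?_
      refine (ae_restrict_iff' measurableSet_Ioi).2 (Eventually.of_forall fun t ht => ?_)
      rw [norm_mul, Real.norm_of_nonneg (Real.exp_pos _).le]
      exact mul_le_mul_of_nonneg_left (psem_bd hγ hb ht hx hM) (Real.exp_pos _).le
    rw [abs_mul, abs_of_pos hl]
    calc lam * |H0 x| ≤ lam * (M / lam) := mul_le_mul_of_nonneg_left this hl.le
      _ = M := by field_simp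
  have hg : ∀ x ≥ 0, |γ * x * H2 x - b * H1 x| ≤ 2 * M := by
    intro x hx
    rw [h.ode x hx]
    have := abs_sub (lam * H0 x) (f x)
    linarith [h0 x hx, hM x hx]
  have ha : 0 < b / γ := by positivity
  rcases hx.eq_or_lt with rfl | hx
  · have := hg 0 le_rfl
    rw [mul_zero, zero_mul, zero_sub, abs_neg, abs_mul, abs_of_pos hb] at this
    rw [div_mul_eq_mul_div, le_div_iff₀ hb]
    linarith
  · have hd : ∀ s > 0, HasDerivAt (fun s : ℝ => s ^ (b / γ) * H1 s)
        (-(s ^ (b / γ - 1) / γ * (γ * s * H2 s - b * H1 s))) s := by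
      intro s hs
      have := (Real.hasDerivAt_rpow_const (p := b / γ) (Or.inl hs.ne')).mul (h.hd1 s)
      refine this.congr_deriv ?_
      rw [Real.rpow_sub_one hs.ne']
      field_simp
      ring
    have hd' : ∀ s > 0, HasDerivAt (fun s : ℝ => 2 / b * M * s ^ (b / γ))
        (s ^ (b / γ - 1) / γ * (2 * M)) s := by
      intro s hs
      have := (Real.hasDerivAt_rpow_const (p := b / γ) (Or.inl hs.ne')).const_mul (2 / b * M)
      refine this.congr_deriv ?_
      field_simp
    have hH1 : Continuous H1 := continuous_iff_continuousAt.2 fun x => (h.hd1 x).continuousAt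
    have hpc : Continuous fun s : ℝ => s ^ (b / γ) := Real.continuous_rpow_const ha.le
    have m1 : MonotoneOn (fun s : ℝ => 2 / b * M * s ^ (b / γ) - s ^ (b / γ) * H1 s) (Ici 0) := by
      refine monotoneOn_of_deriv_nonneg (convex_Ici 0) (by fun_prop) ?_ ?_
      · intro s hs
        rw [interior_Ici] at hs
        exact ((hd' s hs).sub (hd s hs)).differentiableAt.differentiableWithinAt
      · intro s hs
        rw [interior_Ici] at hs
        have hs0 : 0 < s := hs
        refine le_of_le_of_eq ?_ ((hd' s hs).sub (hd s hs)).deriv.symm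
        have := (abs_le.1 (hg s hs0.le)).1
        rw [sub_neg_eq_add, ← mul_add]
        exact mul_nonneg (by positivity) (by linarith)
    have m2 : MonotoneOn (fun s : ℝ => 2 / b * M * s ^ (b / γ) + s ^ (b / γ) * H1 s) (Ici 0) := by
      refine monotoneOn_of_deriv_nonneg (convex_Ici 0) (by fun_prop) ?_ ?_
      · intro s hs
        rw [interior_Ici] at hs
        exact ((hd' s hs).add (hd s hs)).differentiableAt.differentiableWithinAt
      · intro s hs
        rw [interior_Ici] at hs
        have hs0 : 0 < s := hs
        refine le_of_le_of_eq ?_ ((hd' s hs).add (hd s hs)).deriv.symm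
        have := (abs_le.1 (hg s hs0.le)).2
        rw [← mul_neg, ← mul_add]
        exact mul_nonneg (by positivity) (by linarith)
    have a1 := m1 self_mem_Ici hx.le hx.le
    have a2 := m2 self_mem_Ici hx.le hx.le
    simp only [Real.zero_rpow ha.ne', mul_zero, zero_mul, sub_zero, add_zero] at a1 a2
    have hp : 0 < x ^ (b / γ) := by positivity
    rw [abs_le]
    constructor
    · by_contra! hc
      nlinarith
    · by_contra! hc
      nlinarith

lemma approx {f : ℝ → ℝ} {l : ℝ} (hf : ContinuousOn f (Ici 0)) (hl : Tendsto f atTop (𝓝 l))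
    {ε : ℝ} (hε : 0 < ε) :
    ∃ p : Polynomial ℝ, ∀ y ≥ (0:ℝ), |p.eval (Real.exp (-y)) - f y| ≤ ε := by
  have hF : ContinuousOn (Function.update (fun s => f (-Real.log s)) 0 l) (Icc 0 1) := by
    intro s hs
    rcases hs.1.eq_or_lt with h0 | h0
    · subst h0
      rw [continuousWithinAt_update_same]
      have h1 : Tendsto (fun s => f (-Real.log s)) (𝓝[>] 0) (𝓝 l) :=
        hl.comp (tendsto_neg_atBot_atTop.comp Real.tendsto_log_nhdsGT_zero)
      refine h1.mono_left (nhdsWithin_mono _ ?_)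
      rintro s ⟨hs, hs'⟩
      exact lt_of_le_of_ne hs.1 (Ne.symm hs')
    · rw [continuousWithinAt_update_of_ne h0.ne']
      have h1 : ContinuousWithinAt (fun s => -Real.log s) (Icc 0 1) s :=
        (Real.continuousAt_log h0.ne').neg.continuousWithinAt
      refine ContinuousWithinAt.comp (t := Ici 0) (hf _ ?_) h1 ?_
      · exact neg_nonneg.2 (Real.log_nonpos hs.1 hs.2)
      · intro u hu
        exact neg_nonneg.2 (Real.log_nonpos hu.1 hu.2)
  obtain ⟨p, hp⟩ := exists_polynomial_near_of_continuousOn 0 1 _ hF ε hε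
  refine ⟨p, fun y hy => ?_⟩
  have := hp (Real.exp (-y)) ⟨(Real.exp_pos _).le, Real.exp_le_one_iff.2 (by linarith)⟩
  rw [Function.update_of_ne (Real.exp_pos _).ne', Real.log_exp, neg_neg] at this
  exact this.le

lemma main_aux {γ b lam l M : ℝ} (hγ : 0 < γ) (hb : 0 < b) (hlam : 0 < lam) {f : ℝ → ℝ}
    (hf : ContinuousOn f (Ici 0)) (hl : Tendsto f atTop (𝓝 l)) (hM : ∀ y ≥ (0:ℝ), |f y| ≤ M) :
    ∃ E : ℝ → ℝ, (∀ x ≥ 0, HasDerivWithinAt (Rs γ b lam f) (E x) (Ici 0) x) ∧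
      ∀ x ≥ 0, |E x| ≤ 2 / b * M := by
  have hpos : ∀ n : ℕ, (0:ℝ) < 1 / ((n:ℝ) + 1) := fun n => by positivity
  have hone : ∀ n : ℕ, 1 / ((n:ℝ) + 1) ≤ 1 := fun n => by
    rw [div_le_one (by positivity)]
    have : (0:ℝ) ≤ n := by positivity
    linarith
  choose p hp using fun n : ℕ => approx hf hl (hpos n)
  choose H0 H1 H2 hT using fun n : ℕ => Tri_poly hγ hb hlam (p n)
  have hc2 : (0:ℝ) < 2 / b := by positivity
  -- differences
  have hdiff : ∀ n m : ℕ, ∀ x ≥ 0, |H1 n x - H1 m x| ≤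
      2 / b * (1 / ((n:ℝ) + 1) + 1 / ((m:ℝ) + 1)) := by
    intro n m x hx
    have h := (hT n).add ((hT m).smul (-1)) hγ hb hlam
    have := h.bound (M := 1 / ((n:ℝ) + 1) + 1 / ((m:ℝ) + 1)) hγ hb hlam (fun y hy => by
      have a1 := abs_le.1 (hp n y hy)
      have a2 := abs_le.1 (hp m y hy)
      rw [abs_le]
      constructor <;> linarith) hx
    simpa [sub_eq_add_neg] using this
  have hfn : ∀ n : ℕ, ∀ y ≥ 0, |(p n).eval (Real.exp (-y))| ≤ M + 1 / ((n:ℝ) + 1) := by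
    intro n y hy
    have a1 := abs_le.1 (hp n y hy)
    have a2 := abs_le.1 (hM y hy)
    rw [abs_le]
    constructor <;> linarith
  have hbd : ∀ n : ℕ, ∀ x ≥ 0, |H1 n x| ≤ 2 / b * (M + 1 / ((n:ℝ) + 1)) :=
    fun n x hx => (hT n).bound hγ hb hlam (hfn n) hx
  have hinv : Tendsto (fun n : ℕ => 1 / ((n:ℝ) + 1)) atTop (𝓝 0) :=
    tendsto_one_div_add_atTop_nhds_zero_nat
  have hlim : ∀ x, ∃ e, Tendsto (fun n => -H1 n (max x 0)) atTop (𝓝 e) := by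
    intro x
    refine cauchySeq_tendsto_of_complete (Metric.cauchySeq_iff'.2 fun ε hε => ?_)
    obtain ⟨N, hN⟩ := ((hinv.const_mul (2 / b * 2)).eventually (gt_mem_nhds (by simpa using hε))).exists
    refine ⟨N, fun n hn => ?_⟩
    rw [Real.dist_eq, neg_sub_neg, abs_sub_comm]
    refine lt_of_le_of_lt (hdiff n N _ (le_max_right _ _)) (lt_of_le_of_lt ?_ hN)
    have : 1 / ((n:ℝ) + 1) ≤ 1 / ((N:ℝ) + 1) := Nat.one_div_le_one_div hn
    nlinarith
  choose E hE using hlim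
  have hEn : ∀ n x, |(-H1 n (max x 0)) - E x| ≤ 2 / b * (1 / ((n:ℝ) + 1)) := by
    intro n x
    have h1 : Tendsto (fun m => |(-H1 n (max x 0)) - (-H1 m (max x 0))|) atTop
        (𝓝 |(-H1 n (max x 0)) - E x|) := ((hE x).const_sub _).abs
    have h2 : Tendsto (fun m : ℕ => 2 / b * (1 / ((n:ℝ) + 1) + 1 / ((m:ℝ) + 1))) atTop
        (𝓝 (2 / b * (1 / ((n:ℝ) + 1) + 0))) := (hinv.const_add _).const_mul _
    rw [add_zero] at h2
    refine le_of_tendsto_of_tendsto' h1 h2 fun m => ?_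
    rw [neg_sub_neg, abs_sub_comm]
    exact hdiff n m _ (le_max_right _ _)
  have hcn : ∀ n, Continuous fun x => -H1 n (max x 0) := by
    intro n
    have : Continuous (H1 n) := continuous_iff_continuousAt.2 fun x => ((hT n).hd1 x).continuousAt
    fun_prop
  have hinv2 : Tendsto (fun n : ℕ => 2 / b * (1 / ((n:ℝ) + 1))) atTop (𝓝 0) := by
    simpa using hinv.const_mul (2 / b)
  have hEc : Continuous E := by
    have hu : TendstoUniformly (fun n x => -H1 n (max x 0)) E atTop := by
      rw [Metric.tendstoUniformly_iff]
      intro ε hε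
      filter_upwards [hinv2.eventually (gt_mem_nhds hε)] with n hn x
      rw [dist_comm, Real.dist_eq]
      exact (hEn n x).trans_lt hn
    exact hu.continuous (Frequently.of_forall hcn)
  -- convergence of resolvents
  have hR : ∀ x ≥ 0, Tendsto (fun n => H0 n x) atTop (𝓝 (Rs γ b lam f x)) := by
    intro x hx
    simp only [fun n => (hT n).eq x hx]
    refine tendsto_integral_of_dominated_convergence (fun t => Real.exp (-lam * t) * (M + 1))
      (fun n => (hT n).meas x hx) ((expInt hlam).mul_const _) (fun n => ?_) ?_
    · refine (ae_restrict_iff' measurableSet_Ioi).2 (Eventually.of_forall fun t ht => ?_)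
      rw [norm_mul, Real.norm_of_nonneg (Real.exp_pos _).le]
      refine mul_le_mul_of_nonneg_left (psem_bd hγ hb ht hx fun y hy => ?_) (Real.exp_pos _).le
      linarith [hfn n y hy, hone n]
    · refine (ae_restrict_iff' measurableSet_Ioi).2 (Eventually.of_forall fun t ht => ?_)
      refine Tendsto.const_mul _ ?_
      rw [tendsto_iff_dist_tendsto_zero]
      refine squeeze_zero (fun _ => dist_nonneg) (fun n => ?_) hinv
      obtain ⟨N, hN⟩ := (hT n).bdd
      have hneg : ∀ y ≥ (0:ℝ), |(-1) * f y| ≤ M := fun y hy => by simpa using hM y hy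
      have e1 := psem_add (g := fun y => (-1) * f y) hγ hb ht hx (hT n).cont.continuousOn
        (continuousOn_const.mul hf : ContinuousOn (fun y => (-1) * f y) (Ici 0)) hN hneg
      rw [psem_smul] at e1
      rw [Real.dist_eq]
      have e2 := psem_bd (M := 1 / ((n:ℝ) + 1))
        (f := fun y => (p n).eval (Real.exp (-y)) + (-1) * f y) hγ hb ht hx (fun y hy => by
        simpa [sub_eq_add_neg] using hp n y hy)
      rw [e1] at e2
      simpa [sub_eq_add_neg] using e2
  -- integral formula
  have hint : ∀ x ≥ 0, Rs γ b lam f x = Rs γ b lam f 0 + ∫ s in (0:ℝ)..x, E s := by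
    intro x hx
    have hn : ∀ n, H0 n x = H0 n 0 + ∫ s in (0:ℝ)..x, -H1 n (max s 0) := by
      intro n
      have : ∫ s in (0:ℝ)..x, -H1 n (max s 0) = H0 n x - H0 n 0 := by
        refine intervalIntegral.integral_eq_sub_of_hasDerivAt (fun s hs => ?_)
          ((hcn n).intervalIntegrable _ _)
        rw [uIcc_of_le hx] at hs
        rw [max_eq_left hs.1]
        exact (hT n).hd0 s
      rw [this]; ring
    have hi : Tendsto (fun n => ∫ s in (0:ℝ)..x, -H1 n (max s 0)) atTop
        (𝓝 (∫ s in (0:ℝ)..x, E s)) := by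
      rw [tendsto_iff_dist_tendsto_zero]
      have h0 := hinv2.mul_const |x - 0|
      rw [zero_mul] at h0
      refine squeeze_zero (fun _ => dist_nonneg) (fun n => ?_) h0
      rw [Real.dist_eq, ← intervalIntegral.integral_sub ((hcn n).intervalIntegrable _ _)
        (hEc.intervalIntegrable _ _)]
      rw [← Real.norm_eq_abs]
      exact intervalIntegral.norm_integral_le_of_norm_le_const
        (f := fun s => -H1 n (max s 0) - E s) (C := 2 / b * (1 / ((n:ℝ) + 1))) fun s _ => hEn n s
    refine tendsto_nhds_unique (hR x hx) ?_
    simp only [hn]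
    exact (hR 0 le_rfl).add hi
  refine ⟨E, fun x hx => ?_, fun x hx => ?_⟩
  · have h1 : HasDerivAt (fun x => Rs γ b lam f 0 + ∫ s in (0:ℝ)..x, E s) (E x) x :=
      (hEc.integral_hasStrictDerivAt 0 x).hasDerivAt.const_add _
    exact h1.hasDerivWithinAt.congr (fun y hy => hint y hy) (hint x hx)
  · have h2 : Tendsto (fun m : ℕ => 2 / b * (M + 1 / ((m:ℝ) + 1))) atTop
        (𝓝 (2 / b * (M + 0))) := (hinv.const_add _).const_mul _
    rw [add_zero] at h2
    refine le_of_tendsto_of_tendsto' (hE x).abs h2 fun m => ?_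
    rw [abs_neg]
    exact hbd m _ (le_max_right _ _)

lemma bdd_aux {f : ℝ → ℝ} {l : ℝ} (hf : ContinuousOn f (Ici 0)) (hl : Tendsto f atTop (𝓝 l)) :
    ∀ y ≥ (0:ℝ), |f y| ≤ supIci f := by
  obtain ⟨p, hp⟩ := approx hf hl one_pos
  obtain ⟨_, _, _, h⟩ := Tri_poly (γ := 1) (b := 1) (lam := 1) one_pos one_pos one_pos p
  obtain ⟨M, hM⟩ := h.bdd
  intro y hy
  refine le_ciSup (f := fun y : Ici (0:ℝ) => |f (y : ℝ)|) ⟨M + 1, ?_⟩ ⟨y, hy⟩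
  rintro _ ⟨⟨z, hz⟩, rfl⟩
  have a1 := abs_le.1 (hp z hz)
  have a2 := abs_le.1 (hM z hz)
  show |f z| ≤ M + 1
  rw [abs_le]
  constructor <;> linarith

end Aux

/-- There is `C > 0` such that for all `γ > 0`, `b > 0`, `λ > 0` and all `f ∈ C([0,∞])`, the
resolvent `R_λ f : x ↦ ∫_0^∞ e^{−λt} P_t^{γ,b} f(x) dt` is differentiable on `[0,∞)` and
`|(R_λ f)'(x)| ≤ (1/γ) max{2, γ/b} C ‖f‖_∞` for every `x ≥ 0`. -/
theorem stmt19 :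
    ∃ C > (0:ℝ), ∀ γ b lam : ℝ, 0 < γ → 0 < b → 0 < lam → ∀ f : ℝ → ℝ,
      ContinuousOn f (Set.Ici 0) →
      (∃ l, Filter.Tendsto f Filter.atTop (nhds l)) →
      DifferentiableOn ℝ
        (fun x => ∫ t in Set.Ioi (0:ℝ), Real.exp (-lam * t) * Psem γ b t f x) (Set.Ici 0) ∧
      ∀ x ≥ (0:ℝ),
        |derivWithin (fun x => ∫ t in Set.Ioi (0:ℝ), Real.exp (-lam * t) * Psem γ b t f x)
            (Set.Ici 0) x| ≤
          (1 / γ) * max 2 (γ / b) * C * supIci f := by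
  refine ⟨2, two_pos, fun γ b lam hγ hb hlam f hf ⟨l, hl⟩ => ?_⟩
  have hM := bdd_aux hf hl
  obtain ⟨E, hE, hEb⟩ := main_aux hγ hb hlam hf hl hM
  refine ⟨fun x hx => (hE x hx).differentiableWithinAt, fun x hx => ?_⟩
  have h1 := (hE x hx).derivWithin (uniqueDiffOn_Ici 0 x hx)
  refine (congrArg abs h1).le.trans ((hEb x hx).trans ?_)
  have hs : 0 ≤ supIci f := (abs_nonneg _).trans (hM 0 le_rfl)
  have h2 : 1 / b ≤ 1 / γ * max 2 (γ / b) := by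
    calc 1 / b = 1 / γ * (γ / b) := by field_simp
      _ ≤ _ := mul_le_mul_of_nonneg_left (le_max_right _ _) (by positivity)
  refine mul_le_mul_of_nonneg_right ?_ hs
  calc 2 / b = 1 / b * 2 := by ring
    _ ≤ _ := mul_le_mul_of_nonneg_right h2 two_pos.le
end
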